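/- For every ε > 0 there exist δ > 0 and a positive integer N such that for every n ≥ N the following holds: if G is a simple graph on n vertices whose independence number is at most δn, and the edge set of G can be partitioned into two sets E₁ and E₂ such that the graph (V(G), E₁) contains no clique on 3 vertices and the graph (V(G), E₂) contains no clique on 6 vertices, then the number of edges of G is at most (5/12 + ε)·n². -/

import Mathlib

open Classical in
/-- splitting the total weight around a vertex -/
lemma rt_star {ι : Type*} (W : Finset ι) (x : ι → ℝ) (r f h : ι → ι → Prop)
    (hx : ∀ i ∈ W, 0 ≤ x i)
    (hall : ∀ i ∈ W, ∀ j ∈ W, i ≠ j → r i j ∨ f i j ∨ h i j)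
    (v : ι) (hv : v ∈ W) :
    ∑ i ∈ W, x i ≤ x v + ∑ j ∈ W with (j ≠ v ∧ r v j), x j
      + ∑ j ∈ W with (j ≠ v ∧ f v j), x j + ∑ j ∈ W with (j ≠ v ∧ h v j), x j := by
  have h1 : x v = ∑ j ∈ W, if j = v then x j else 0 := by
    simp [hv]
  rw [h1, Finset.sum_filter, Finset.sum_filter, Finset.sum_filter, ← Finset.sum_add_distrib,
    ← Finset.sum_add_distrib, ← Finset.sum_add_distrib]
  apply Finset.sum_le_sum
  intro i hi
  have := hx i hi
  by_cases hiv : i = v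
  · subst hiv; simp
  · have h3 := hall v hv i hi (Ne.symm hiv)
    by_cases a : r v i <;> by_cases b : f v i <;> by_cases c : h v i <;>
      simp [hiv, a, b, c] <;> first | linarith | tauto

open Classical in
lemma rt_sum_le_of_subset {ι : Type*} (W : Finset ι) (x : ι → ℝ) (h : ι → ι → Prop)
    (hx : ∀ i ∈ W, 0 ≤ x i)
    (hc : ∀ i ∈ W, x i + 1 / 2 * ∑ j ∈ W with (j ≠ i ∧ h i j), x j ≤ 1)
    (i : ι) (hi : i ∈ W) (S : Finset ι) (hS : S ⊆ W) (hSh : ∀ j ∈ S, j ≠ i ∧ h i j) :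
    x i + 1 / 2 * ∑ j ∈ S, x j ≤ 1 := by
  have h1 : ∑ j ∈ S, x j ≤ ∑ j ∈ W with (j ≠ i ∧ h i j), x j := by
    apply Finset.sum_le_sum_of_subset_of_nonneg
    · intro j hj
      exact Finset.mem_filter.2 ⟨hS hj, hSh j hj⟩
    · intro j hj _
      exact hx j (Finset.mem_filter.1 hj).1
  have := hc i hi
  linarith

open Classical in
lemma rt_pair {ι : Type*} (W : Finset ι) (x : ι → ℝ) (h : ι → ι → Prop)
    (hx : ∀ i ∈ W, 0 ≤ x i)
    (hc : ∀ i ∈ W, x i + 1 / 2 * ∑ j ∈ W with (j ≠ i ∧ h i j), x j ≤ 1)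
    (hs : ∀ i j, h i j → h j i)
    (i j : ι) (hi : i ∈ W) (hj : j ∈ W) (hij : i ≠ j) (hh : h i j) :
    x i + x j ≤ 4 / 3 := by
  have h1 := rt_sum_le_of_subset W x h hx hc i hi {j} (by simpa using hj)
    (by simp [hij.symm, hh])
  have h2 := rt_sum_le_of_subset W x h hx hc j hj {i} (by simpa using hi)
    (by simp [hij, hs _ _ hh])
  simp at h1 h2
  linarith

open Classical in
lemma rt_le_one {ι : Type*} (W : Finset ι) (x : ι → ℝ) (h : ι → ι → Prop)
    (hx : ∀ i ∈ W, 0 ≤ x i)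
    (hc : ∀ i ∈ W, x i + 1 / 2 * ∑ j ∈ W with (j ≠ i ∧ h i j), x j ≤ 1)
    (i : ι) (hi : i ∈ W) : x i ≤ 1 := by
  have h1 := rt_sum_le_of_subset W x h hx hc i hi ∅ (by simp) (by simp)
  simpa using h1

open Classical in
lemma rt_triple {ι : Type*} (W : Finset ι) (x : ι → ℝ) (h : ι → ι → Prop)
    (hx : ∀ i ∈ W, 0 ≤ x i)
    (hc : ∀ i ∈ W, x i + 1 / 2 * ∑ j ∈ W with (j ≠ i ∧ h i j), x j ≤ 1)
    (i j k : ι) (hi : i ∈ W) (hj : j ∈ W) (hk : k ∈ W) (hij : i ≠ j) (hik : i ≠ k) (hjk : j ≠ k)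
    (hh : h i j) (hh' : h i k) : x i + (x j + x k) / 2 ≤ 1 := by
  have h1 := rt_sum_le_of_subset W x h hx hc i hi {j, k}
    (by intro a; simp; rintro (rfl | rfl) <;> assumption)
    (by intro a; simp; rintro (rfl | rfl) <;> simp [*, hij.symm, hik.symm])
  rw [Finset.sum_pair hjk] at h1
  linarith

open Classical in
lemma rt_quad {ι : Type*} (W : Finset ι) (x : ι → ℝ) (h : ι → ι → Prop)
    (hx : ∀ i ∈ W, 0 ≤ x i)
    (hc : ∀ i ∈ W, x i + 1 / 2 * ∑ j ∈ W with (j ≠ i ∧ h i j), x j ≤ 1)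
    (i j k l : ι) (hi : i ∈ W) (hj : j ∈ W) (hk : k ∈ W) (hl : l ∈ W)
    (hij : i ≠ j) (hik : i ≠ k) (hil : i ≠ l) (hjk : j ≠ k) (hjl : j ≠ l) (hkl : k ≠ l)
    (h1 : h i j) (h2 : h i k) (h3 : h i l) : x i + (x j + x k + x l) / 2 ≤ 1 := by
  have h1 := rt_sum_le_of_subset W x h hx hc i hi {j, k, l}
    (by intro a; simp; rintro (rfl | rfl | rfl) <;> assumption)
    (by intro a; simp; rintro (rfl | rfl | rfl) <;> simp [*, hij.symm, hik.symm, hil.symm])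
  rw [Finset.sum_insert (by simp [*]), Finset.sum_pair hkl] at h1
  linarith

open Classical in
/-- a set with only red and half edges, both triangle free, has weight at most 8/3 -/
lemma rt_no_full {ι : Type*} (W : Finset ι) (x : ι → ℝ) (r h : ι → ι → Prop)
    (hx : ∀ i ∈ W, 0 ≤ x i)
    (hc : ∀ i ∈ W, x i + 1 / 2 * ∑ j ∈ W with (j ≠ i ∧ h i j), x j ≤ 1)
    (hs : ∀ i j, h i j → h j i)
    (hall : ∀ i ∈ W, ∀ j ∈ W, i ≠ j → r i j ∨ h i j)
    (hr : ∀ i ∈ W, ∀ j ∈ W, ∀ k ∈ W, i ≠ j → i ≠ k → j ≠ k → r i j → r i k → r j k → False)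
    (hh : ∀ i ∈ W, ∀ j ∈ W, ∀ k ∈ W, i ≠ j → i ≠ k → j ≠ k → h i j → h i k → h j k → False) :
    ∑ i ∈ W, x i ≤ 8 / 3 := by
  rcases W.eq_empty_or_nonempty with rfl | hne
  · simp; norm_num
  obtain ⟨v, hv, hmax⟩ := W.exists_max_image x hne
  have h0 := rt_star W x r (fun _ _ => False) h hx (by
    intro i hi j hj hij; have := hall i hi j hj hij; tauto) v hv
  simp only [and_false, Finset.filter_false, Finset.sum_empty] at h0
  have h1 := hc v hv
  have hx0 := hx v hv
  have hx1 := rt_le_one W x h hx hc v hv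
  set P := W.filter (fun j => j ≠ v ∧ r v j) with hP
  have hPm : ∀ j ∈ P, j ∈ W ∧ j ≠ v ∧ r v j := fun j hj => by simpa [hP] using hj
  have hPh : ∀ j ∈ P, ∀ k ∈ P, j ≠ k → h j k := by
    intro j hj k hk hjk
    obtain ⟨a, b, c⟩ := hPm j hj
    obtain ⟨a', b', c'⟩ := hPm k hk
    rcases hall j a k a' hjk with h | h
    · exact (hr v hv j a k a' b.symm b'.symm hjk c c' h).elim
    · exact h
  have key : ∑ j ∈ P, x j ≤ 4 / 3 ∧ ∑ j ∈ P, x j ≤ 2 * x v := by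
    have hcard : P.card ≤ 2 := by
      by_contra hcon
      push Not at hcon
      obtain ⟨a, ha, b, hb, c, hc', hab, hac, hbc⟩ := Finset.two_lt_card.1 hcon
      exact hh a (hPm a ha).1 b (hPm b hb).1 c (hPm c hc').1 hab hac hbc (hPh a ha b hb hab)
        (hPh a ha c hc' hac) (hPh b hb c hc' hbc)
    interval_cases hk : P.card
    · rw [Finset.card_eq_zero] at hk
      rw [hk]; simp; constructor <;> linarith
    · obtain ⟨a, ha⟩ := Finset.card_eq_one.1 hk
      have haP : a ∈ P := by simp [ha]
      have e1 := hmax a (hPm a haP).1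
      rw [ha]; simp; constructor <;> linarith
    · obtain ⟨a, b, hab, ha⟩ := Finset.card_eq_two.1 hk
      have haP : a ∈ P := by simp [ha]
      have hbP : b ∈ P := by simp [ha]
      have e1 := hmax a (hPm a haP).1
      have e2 := hmax b (hPm b hbP).1
      have e3 := rt_pair W x h hx hc hs a b (hPm a haP).1 (hPm b hbP).1 hab (hPh a haP b hbP hab)
      rw [ha, Finset.sum_pair hab]; constructor <;> linarith
  linarith [key.1, key.2]

set_option maxHeartbeats 2000000 in
open Classical in
/-- the weight of the blue-type clusters -/
lemma rt_blue_part {ι : Type*} (W : Finset ι) (x : ι → ℝ) (r f h : ι → ι → Prop) (s : ℕ)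
    (hs2 : s ≤ 5)
    (hx : ∀ i ∈ W, 0 ≤ x i)
    (hc : ∀ i ∈ W, x i + 1 / 2 * ∑ j ∈ W with (j ≠ i ∧ h i j), x j ≤ 1)
    (hfs : ∀ i j, f i j → f j i) (hs : ∀ i j, h i j → h j i)
    (hall : ∀ i ∈ W, ∀ j ∈ W, i ≠ j → r i j ∨ f i j ∨ h i j)
    (hr : ∀ i ∈ W, ∀ j ∈ W, ∀ k ∈ W, i ≠ j → i ≠ k → j ≠ k → r i j → r i k → r j k → False)
    (hST : ∀ S T : Finset ι, T ⊆ S → S ⊆ W → (S : Set ι).Pairwise (fun i j => f i j ∨ h i j) →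
      (T : Set ι).Pairwise f → S.card + T.card ≠ s + 1) :
    ∑ i ∈ W, x i ≤ s + 1 := by
  rcases W.eq_empty_or_nonempty with rfl | hne
  · simp; positivity
  obtain ⟨v, hv, hmax⟩ := W.exists_max_image x hne
  have h0 := rt_star W x r f h hx hall v hv
  have h1 := hc v hv
  have hx0 := hx v hv
  have hx1 := rt_le_one W x h hx hc v hv
  have hbs : ∀ i j, f i j ∨ h i j → f j i ∨ h j i := by
    intro i j hij; exact hij.imp (hfs i j) (hs i j)
  set P := W.filter (fun j => j ≠ v ∧ r v j) with hP
  have hPm : ∀ j ∈ P, j ∈ W ∧ j ≠ v ∧ r v j := fun j hj => by simpa [hP] using hj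
  have hPW : P ⊆ W := Finset.filter_subset _ _
  have hPb : ∀ j ∈ P, ∀ k ∈ P, j ≠ k → f j k ∨ h j k := by
    intro j hj k hk hjk
    obtain ⟨a, b, c⟩ := hPm j hj
    obtain ⟨a', b', c'⟩ := hPm k hk
    rcases hall j a k a' hjk with h | h
    · exact (hr v hv j a k a' b.symm b'.symm hjk c c' h).elim
    · exact h
  set Q := W.filter (fun j => j ≠ v ∧ f v j) with hQ
  have hQm : ∀ j ∈ Q, j ∈ W ∧ j ≠ v ∧ f v j := fun j hj => by simpa [hQ] using hj
  have hQW : Q ⊆ W := Finset.filter_subset _ _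
  -- convenient forms of the forbidden configurations
  have forb : ∀ S ⊆ W, ∀ t ≤ 1, (S : Set ι).Pairwise (fun i j => f i j ∨ h i j) → S.Nonempty →
      S.card + t ≠ s + 1 := by
    intro S hSW t ht hS hSn
    obtain ⟨a, ha⟩ := hSn
    interval_cases t
    · have := hST S ∅ (by simp) hSW hS (by simp)
      simpa using this
    · have := hST S {a} (by simpa using ha) hSW hS (by simp)
      simpa using this
  have forb2 : ∀ S ⊆ W, (S : Set ι).Pairwise (fun i j => f i j ∨ h i j) → ∀ a ∈ S, ∀ b ∈ S,
      a ≠ b → f a b → S.card + 2 ≠ s + 1 := by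
    intro S hSW hS a ha b hb hab hf
    have := hST S {a, b} (by intro c; simp; rintro (rfl | rfl) <;> assumption) hSW hS (by
      intro c hc d hd hcd
      simp at hc hd
      rcases hc with rfl | rfl <;> rcases hd with rfl | rfl
      · exact absurd rfl hcd
      · exact hf
      · exact hfs _ _ hf
      · exact absurd rfl hcd)
    rwa [Finset.card_pair hab] at this
  have pw : ∀ a b : ι, a ≠ b → (f a b ∨ h a b) →
      (({a, b} : Finset ι) : Set ι).Pairwise (fun i j => f i j ∨ h i j) := by
    intro a b hab hf c hc d hd hcd
    simp at hc hd
    rcases hc with rfl | rfl <;> rcases hd with rfl | rfl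
    · exact absurd rfl hcd
    · exact hf
    · exact hbs _ _ hf
    · exact absurd rfl hcd
  have pwi : ∀ (a : ι) (S : Finset ι), (∀ b ∈ S, f a b ∨ h a b) →
      (S : Set ι).Pairwise (fun i j => f i j ∨ h i j) →
      ((insert a S : Finset ι) : Set ι).Pairwise (fun i j => f i j ∨ h i j) := by
    intro a S hab hS c hc d hd hcd
    simp at hc hd
    rcases hc with rfl | hc <;> rcases hd with rfl | hd
    · exact absurd rfl hcd
    · exact hab _ hd
    · exact hbs _ _ (hab _ hc)
    · exact hS hc hd hcd
  have hPpw : (P : Set ι).Pairwise (fun i j => f i j ∨ h i j) := by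
    intro c hc d hd hcd
    exact hPb c hc d hd hcd
  have hPcard : P.card < s := by
    by_contra hcon
    push Not at hcon
    obtain ⟨S, hSP, hScard⟩ := Finset.exists_subset_card_eq hcon
    have hSW := hSP.trans hPW
    rcases Nat.eq_zero_or_pos s with h0 | h0
    · exact forb {v} (by simpa using hv) 0 (by simp) (by simp) (by simp) (by simp [h0])
    · exact forb S hSW 1 le_rfl (hPpw.mono (by exact_mod_cast hSP))
        (Finset.card_pos.1 (by omega)) (by omega)
  -- bounds on P, one at a time
  have P0 : P.card = 0 → ∑ j ∈ P, x j = 0 := by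
    intro hk
    rw [Finset.card_eq_zero] at hk
    rw [hk]; simp
  have P1 : P.card = 1 → ∑ j ∈ P, x j ≤ x v := by
    intro hk
    obtain ⟨a, ha⟩ := Finset.card_eq_one.1 hk
    have haP : a ∈ P := by simp [ha]
    have e1 := hmax a (hPm a haP).1
    rw [ha]; simpa using e1
  have P2 : P.card = 2 → ∑ j ∈ P, x j ≤ 2 * x v := by
    intro hk
    obtain ⟨a, b, hab, ha⟩ := Finset.card_eq_two.1 hk
    have haP : a ∈ P := by simp [ha]
    have hbP : b ∈ P := by simp [ha]
    have e1 := hmax a (hPm a haP).1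
    have e2 := hmax b (hPm b hbP).1
    rw [ha, Finset.sum_pair hab]; linarith
  have hQ0 : 0 ≤ ∑ j ∈ Q, x j := Finset.sum_nonneg fun j hj => hx j (hQW hj)
  have hQempty : s ≤ 3 → ∑ j ∈ Q, x j = 0 := by
    intro hs3
    have : Q = ∅ := by
      by_contra hcon
      obtain ⟨a, ha⟩ := Finset.nonempty_iff_ne_empty.2 hcon
      obtain ⟨b1, b2, b3⟩ := hQm a ha
      have hsub : ({v, a} : Finset ι) ⊆ W := by
        intro c; simp; rintro (rfl | rfl) <;> assumption
      have hcd : ({v, a} : Finset ι).card = 2 := Finset.card_pair b2.symm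
      have hpw := pw v a b2.symm (Or.inl b3)
      have c1 := forb _ hsub 0 (by simp) hpw (by simp)
      have c2 := forb _ hsub 1 (by simp) hpw (by simp)
      have c3 := forb2 _ hsub hpw v (by simp) a (by simp) b2.symm b3
      have c4 := forb {v} (by simpa using hv) 0 (by simp) (by simp) (by simp)
      rw [hcd] at c1 c2 c3
      simp at c4
      omega
    rw [this]; simp
  interval_cases s
  · omega
  · -- s = 1 : a single vertex is already too much
    exact absurd rfl (forb {v} (by simpa using hv) 1 le_rfl (by simp) (by simp))
  · -- s = 2
    have hQ' := hQempty (by norm_num)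
    have hHe : ∑ j ∈ W with (j ≠ v ∧ h v j), x j = 0 := by
      apply Finset.sum_eq_zero
      intro a ha
      obtain ⟨b1, b2, b3⟩ := Finset.mem_filter.1 ha
      exact absurd (by rw [Finset.card_pair b2.symm]) (forb {v, a} (by
        intro c; simp; rintro (rfl | rfl) <;> assumption) 1 le_rfl (pw v a b2.symm (Or.inr b3))
        (by simp))
    have : ∑ j ∈ P, x j ≤ x v := by
      interval_cases hk : P.card
      · linarith [P0 rfl]
      · exact P1 rfl
    push_cast
    linarith
  · -- s = 3
    have hQ' := hQempty (by norm_num)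
    have : ∑ j ∈ P, x j ≤ 2 * x v := by
      interval_cases hk : P.card
      · linarith [P0 rfl]
      · linarith [P1 rfl]
      · exact P2 rfl
    push_cast
    linarith
  · -- s = 4
    have hQred : ∀ a ∈ Q, ∀ b ∈ Q, a ≠ b → r a b := by
      intro a ha b hb hab
      obtain ⟨a1, a2, a3⟩ := hQm a ha
      obtain ⟨b1, b2, b3⟩ := hQm b hb
      rcases hall a a1 b b1 hab with h | h
      · exact h
      · exfalso
        refine forb2 {v, a, b} ?_ (pwi v {a, b} ?_ (pw a b hab h)) v (by simp) a (by simp) a2.symm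
          a3 ?_
        · intro c; simp; rintro (rfl | rfl | rfl) <;> assumption
        · intro c; simp; rintro (rfl | rfl) <;> tauto
        · rw [Finset.card_insert_of_notMem (by simp [a2.symm, b2.symm]), Finset.card_pair hab]
    have hQcard : Q.card ≤ 2 := by
      by_contra hcon
      push Not at hcon
      obtain ⟨a, ha, b, hb, c, hc', hab, hac, hbc⟩ := Finset.two_lt_card.1 hcon
      exact hr a (hQm a ha).1 b (hQm b hb).1 c (hQm c hc').1 hab hac hbc (hQred a ha b hb hab)
        (hQred a ha c hc' hac) (hQred b hb c hc' hbc)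
    have hQ2 : ∑ j ∈ Q, x j ≤ 2 := by
      calc ∑ j ∈ Q, x j ≤ ∑ j ∈ Q, (1 : ℝ) :=
            Finset.sum_le_sum fun j hj => rt_le_one W x h hx hc j (hQW hj)
        _ = Q.card := by simp
        _ ≤ 2 := by exact_mod_cast hQcard
    have : ∑ j ∈ P, x j ≤ x v + 1 := by
      interval_cases hk : P.card
      · linarith [P0 rfl]
      · linarith [P1 rfl]
      · linarith [P2 rfl]
      · obtain ⟨a, b, c, hab, hac, hbc, hP3⟩ := Finset.card_eq_three.1 hk
        have haP : a ∈ P := by simp [hP3]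
        have hbP : b ∈ P := by simp [hP3]
        have hcP : c ∈ P := by simp [hP3]
        have hPh : ∀ j ∈ P, ∀ k ∈ P, j ≠ k → h j k := by
          intro j hj k hk' hjk
          rcases hPb j hj k hk' hjk with h | h
          · exact absurd (by rw [hk]) (forb2 P hPW hPpw j hj k hk' hjk h)
          · exact h
        have e1 := hmax a (hPm a haP).1
        have e2 := hmax b (hPm b hbP).1
        have e3 := hmax c (hPm c hcP).1
        have t1 := rt_triple W x h hx hc a b c (hPW haP) (hPW hbP) (hPW hcP) hab hac hbc
          (hPh _ haP _ hbP hab) (hPh _ haP _ hcP hac)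
        have t2 := rt_triple W x h hx hc b a c (hPW hbP) (hPW haP) (hPW hcP) hab.symm hbc hac
          (hPh _ hbP _ haP hab.symm) (hPh _ hbP _ hcP hbc)
        have t3 := rt_triple W x h hx hc c a b (hPW hcP) (hPW haP) (hPW hbP) hac.symm hbc.symm hab
          (hPh _ hcP _ haP hac.symm) (hPh _ hcP _ hbP hbc.symm)
        rw [hP3, Finset.sum_insert (by simp [hab, hac]), Finset.sum_pair hbc]
        linarith
    push_cast
    linarith
  · -- s = 5
    have hQnf : ∀ a ∈ Q, ∀ b ∈ Q, a ≠ b → ¬ f a b := by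
      intro a ha b hb hab hf
      obtain ⟨a1, a2, a3⟩ := hQm a ha
      obtain ⟨b1, b2, b3⟩ := hQm b hb
      have hcd : ({v, a, b} : Finset ι).card = 3 := by
        rw [Finset.card_insert_of_notMem (by simp [a2.symm, b2.symm]), Finset.card_pair hab]
      refine hST {v, a, b} {v, a, b} subset_rfl ?_
        (pwi v {a, b} ?_ (pw a b hab (Or.inl hf))) ?_ (by rw [hcd])
      · intro c; simp; rintro (rfl | rfl | rfl) <;> assumption
      · intro c; simp; rintro (rfl | rfl) <;> tauto
      · intro c hc d hd hne'
        simp at hc hd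
        have := hfs _ _ a3
        have := hfs _ _ b3
        have := hfs _ _ hf
        rcases hc with rfl | rfl | rfl <;> rcases hd with rfl | rfl | rfl <;>
          first | exact absurd rfl hne' | assumption
    have hQ3 : ∑ j ∈ Q, x j ≤ 8 / 3 := by
      refine rt_no_full Q x r h (fun i hi => hx i (hQW hi)) ?_ hs ?_ ?_ ?_
      · intro i hi
        exact rt_sum_le_of_subset W x h hx hc i (hQW hi) _
          ((Finset.filter_subset _ _).trans hQW) (fun j hj => (Finset.mem_filter.1 hj).2)
      · intro i hi j hj hij
        have := hall i (hQW hi) j (hQW hj) hij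
        have := hQnf i hi j hj hij
        tauto
      · intro i hi j hj k hk
        exact hr i (hQW hi) j (hQW hj) k (hQW hk)
      · intro i hi j hj k hk hij hik hjk h1 h2 h3
        obtain ⟨a1, a2, a3⟩ := hQm i hi
        obtain ⟨b1, b2, b3⟩ := hQm j hj
        obtain ⟨c1, c2, c3⟩ := hQm k hk
        refine forb2 {v, i, j, k} ?_ (pwi v _ ?_ (pwi i _ ?_ (pw j k hjk (Or.inr h3))))
          v (by simp) i (by simp) a2.symm a3 ?_
        · intro c; simp; rintro (rfl | rfl | rfl | rfl) <;> assumption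
        · intro c; simp; rintro (rfl | rfl | rfl) <;> tauto
        · intro c; simp; rintro (rfl | rfl) <;> tauto
        · rw [Finset.card_insert_of_notMem (by simp [a2.symm, b2.symm, c2.symm]),
            Finset.card_insert_of_notMem (by simp [hij, hik]), Finset.card_pair hjk]
    have : ∑ j ∈ P, x j ≤ x v + 4 / 3 := by
      interval_cases hk : P.card
      · linarith [P0 rfl]
      · linarith [P1 rfl]
      · linarith [P2 rfl]
      · obtain ⟨a, b, c, hab, hac, hbc, hP3⟩ := Finset.card_eq_three.1 hk
        have haP : a ∈ P := by simp [hP3]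
        have hbP : b ∈ P := by simp [hP3]
        have hcP : c ∈ P := by simp [hP3]
        have e1 := hmax a (hPm a haP).1
        have e2 := hmax b (hPm b hbP).1
        have e3 := hmax c (hPm c hcP).1
        have hsum : ∑ j ∈ P, x j = x a + (x b + x c) := by
          rw [hP3, Finset.sum_insert (by simp [hab, hac]), Finset.sum_pair hbc]
        rw [hsum]
        rcases hPb a haP b hbP hab with h1 | h1
        · rcases hPb a haP c hcP hac with h2 | h2
          · rcases hPb b hbP c hcP hbc with h3 | h3
            · exfalso
              refine hST P P subset_rfl hPW hPpw ?_ (by rw [hk])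
              intro d hd e he hde
              have := hfs _ _ h1
              have := hfs _ _ h2
              have := hfs _ _ h3
              rw [hP3] at hd he
              simp at hd he
              rcases hd with rfl | rfl | rfl <;> rcases he with rfl | rfl | rfl <;>
                first | exact absurd rfl hde | assumption
            · have := rt_pair W x h hx hc hs b c (hPW hbP) (hPW hcP) hbc h3
              linarith
          · have := rt_pair W x h hx hc hs a c (hPW haP) (hPW hcP) hac h2
            linarith
        · have := rt_pair W x h hx hc hs a b (hPW haP) (hPW hbP) hab h1
          linarith
      · have hPh : ∀ j ∈ P, ∀ k ∈ P, j ≠ k → h j k := by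
          intro j hj k hk' hjk
          rcases hPb j hj k hk' hjk with h | h
          · exact absurd (by rw [hk]) (forb2 P hPW hPpw j hj k hk' hjk h)
          · exact h
        obtain ⟨d, hdP⟩ : P.Nonempty := Finset.card_pos.1 (by omega)
        have hk3 : (P.erase d).card = 3 := by rw [Finset.card_erase_of_mem hdP, hk]
        obtain ⟨a, b, c, hab, hac, hbc, hP3⟩ := Finset.card_eq_three.1 hk3
        have haP' : a ∈ P.erase d := by simp [hP3]
        have hbP' : b ∈ P.erase d := by simp [hP3]
        have hcP' : c ∈ P.erase d := by simp [hP3]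
        have haP := Finset.mem_of_mem_erase haP'
        have hbP := Finset.mem_of_mem_erase hbP'
        have hcP := Finset.mem_of_mem_erase hcP'
        have had := Finset.ne_of_mem_erase haP'
        have hbd := Finset.ne_of_mem_erase hbP'
        have hcd := Finset.ne_of_mem_erase hcP'
        have e1 := hmax a (hPm a haP).1
        have e2 := hmax b (hPm b hbP).1
        have e3 := hmax c (hPm c hcP).1
        have e4 := hmax d (hPm d hdP).1
        have hsum : ∑ j ∈ P, x j = x d + (x a + (x b + x c)) := by
          rw [← Finset.add_sum_erase P x hdP, hP3, Finset.sum_insert (by simp [hab, hac]),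
            Finset.sum_pair hbc]
        have q1 := rt_quad W x h hx hc a b c d (hPW haP) (hPW hbP) (hPW hcP) (hPW hdP) hab hac had
          hbc hbd hcd (hPh _ haP _ hbP hab) (hPh _ haP _ hcP hac) (hPh _ haP _ hdP had)
        have q2 := rt_quad W x h hx hc b a c d (hPW hbP) (hPW haP) (hPW hcP) (hPW hdP) hab.symm hbc
          hbd hac had hcd (hPh _ hbP _ haP hab.symm) (hPh _ hbP _ hcP hbc) (hPh _ hbP _ hdP hbd)
        have q3 := rt_quad W x h hx hc c a b d (hPW hcP) (hPW haP) (hPW hbP) (hPW hdP) hac.symm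
          hbc.symm hcd hab had hbd (hPh _ hcP _ haP hac.symm) (hPh _ hcP _ hbP hbc.symm)
          (hPh _ hcP _ hdP hcd)
        have q4 := rt_quad W x h hx hc d a b c (hPW hdP) (hPW haP) (hPW hbP) (hPW hcP) had.symm
          hbd.symm hcd.symm hab hac hbc (hPh _ hdP _ haP had.symm) (hPh _ hdP _ hbP hbd.symm)
          (hPh _ hdP _ hcP hcd.symm)
        rw [hsum]
        linarith
    push_cast
    linarith

open Classical in
/-- all pairs of clusters are joined: the total weight is at most 6 -/
lemma rt_complete {ι : Type*} (I : Finset ι) (x : ι → ℝ) (isR : ι → Prop)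
    (r b f : ι → ι → Prop)
    (hx : ∀ i ∈ I, 0 ≤ x i)
    (hrs : ∀ i j, r i j → r j i) (hbs : ∀ i j, b i j → b j i) (hfs : ∀ i j, f i j → f j i)
    (hfb : ∀ i j, f i j → b i j)
    (hall : ∀ i ∈ I, ∀ j ∈ I, i ≠ j → r i j ∨ b i j)
    (hrR : ∀ i ∈ I, ∀ j ∈ I, r i j → ¬ isR i ∧ ¬ isR j)
    (hr : ∀ i ∈ I, ∀ j ∈ I, ∀ k ∈ I, i ≠ j → i ≠ k → j ≠ k → r i j → r i k → r j k → False)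
    (hST : ∀ S T : Finset ι, T ⊆ S → S ⊆ I → (S : Set ι).Pairwise b →
      (T : Set ι).Pairwise f → (∀ t ∈ T, ¬ isR t) → S.card + T.card ≠ 6)
    (h : ι → ι → Prop)
    (hh : ∀ i j, h i j ↔ (¬ isR i ∧ ¬ isR j ∧ b i j ∧ ¬ r i j ∧ ¬ f i j))
    (hc : ∀ i ∈ I, x i + 1 / 2 * ∑ j ∈ I with (j ≠ i ∧ h i j), x j ≤ 1) :
    ∑ i ∈ I, x i ≤ 6 := by
  set A := I.filter isR with hA
  set W := I.filter (fun i => ¬ isR i) with hW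
  have hAI : A ⊆ I := Finset.filter_subset _ _
  have hWI : W ⊆ I := Finset.filter_subset _ _
  have hAm : ∀ i ∈ A, i ∈ I ∧ isR i := fun i hi => by simpa [hA] using hi
  have hWm : ∀ i ∈ W, i ∈ I ∧ ¬ isR i := fun i hi => by simpa [hW] using hi
  have hAb : ∀ i ∈ A, ∀ j ∈ I, i ≠ j → b i j := by
    intro i hi j hj hij
    obtain ⟨h1, h2⟩ := hAm i hi
    rcases hall i h1 j hj hij with h | h
    · exact absurd h2 (hrR i h1 j hj h).1
    · exact h
  have hsum : ∑ i ∈ I, x i = ∑ i ∈ A, x i + ∑ i ∈ W, x i := by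
    rw [hA, hW, Finset.sum_filter_add_sum_filter_not]
  have hAcard : A.card ≤ 5 := by
    by_contra hcon
    push Not at hcon
    obtain ⟨S, hSA, hS6⟩ := Finset.exists_subset_card_eq (show 6 ≤ A.card by omega)
    refine hST S ∅ (by simp) (hSA.trans hAI) ?_ (by simp) (by simp) (by simp [hS6])
    intro i hi j hj hij
    exact hAb i (hSA hi) j (hAI (hSA hj)) hij
  have hA1 : ∑ i ∈ A, x i ≤ A.card := by
    calc ∑ i ∈ A, x i ≤ ∑ i ∈ A, (1 : ℝ) := by
          apply Finset.sum_le_sum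
          intro i hi
          exact rt_le_one I x h hx hc i (hAI hi)
      _ = A.card := by simp
  have hB := rt_blue_part W x r f h (5 - A.card) (by omega) (fun i hi => hx i (hWI hi)) (by
      intro i hi
      exact rt_sum_le_of_subset I x h hx hc i (hWI hi) _
          ((Finset.filter_subset _ _).trans hWI) (fun j hj => (Finset.mem_filter.1 hj).2)) hfs
    (by
      intro i j hij
      obtain ⟨h1, h2, h3, h4, h5⟩ := (hh i j).1 hij
      exact (hh j i).2 ⟨h2, h1, hbs _ _ h3, fun h => h4 (hrs _ _ h), fun h => h5 (hfs _ _ h)⟩)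
    (by
      intro i hi j hj hij
      have := hall i (hWI hi) j (hWI hj) hij
      have h1 := (hWm i hi).2
      have h2 := (hWm j hj).2
      simp only [hh]
      tauto)
    (fun i hi j hj k hk => hr i (hWI hi) j (hWI hj) k (hWI hk))
    (by
      intro S T hTS hSW hS hT hcard
      have hdisj : Disjoint S A := by
        rw [Finset.disjoint_left]
        intro a ha ha'
        exact (hWm a (hSW ha)).2 (hAm a ha').2
      refine hST (S ∪ A) T (hTS.trans Finset.subset_union_left)
        (Finset.union_subset (hSW.trans hWI) hAI) ?_ hT
        (fun t ht => (hWm t (hSW (hTS ht))).2) ?_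
      · intro i hi j hj hij
        simp at hi hj
        rcases hi with hi | hi
        · rcases hj with hj | hj
          · rcases hS hi hj hij with h | h
            · exact hfb _ _ h
            · exact ((hh _ _).1 h).2.2.1
          · exact hbs _ _ (hAb j hj i (hWI (hSW hi)) hij.symm)
        · refine hAb i hi j ?_ hij
          rcases hj with hj | hj
          · exact hWI (hSW hj)
          · exact hAI hj
      · rw [Finset.card_union_of_disjoint hdisj]
        omega)
  have : (((5 - A.card : ℕ) : ℝ)) = 5 - A.card := by
    rw [Nat.cast_sub hAcard]; norm_num
  rw [this] at hB
  linarith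

/-- moving weight: the quadratic form along a line -/
lemma rt_quad_line {ι : Type*} (I : Finset ι) (M : ι → ι → ℝ) (hs : ∀ i j, M i j = M j i)
    (y u : ι → ℝ) (t : ℝ) :
    ∑ i ∈ I, ∑ j ∈ I, M i j * ((y i + t * u i) * (y j + t * u j)) =
      ∑ i ∈ I, ∑ j ∈ I, M i j * (y i * y j) + 2 * t * ∑ i ∈ I, u i * ∑ j ∈ I, M i j * y j
        + t ^ 2 * ∑ i ∈ I, u i * ∑ j ∈ I, M i j * u j := by
  have h1 : ∑ i ∈ I, u i * ∑ j ∈ I, M i j * y j = ∑ i ∈ I, ∑ j ∈ I, M i j * (u i * y j) := by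
    apply Finset.sum_congr rfl; intro i _; rw [Finset.mul_sum]
    apply Finset.sum_congr rfl; intro j _; ring
  have h2 : ∑ i ∈ I, u i * ∑ j ∈ I, M i j * u j = ∑ i ∈ I, ∑ j ∈ I, M i j * (u i * u j) := by
    apply Finset.sum_congr rfl; intro i _; rw [Finset.mul_sum]
    apply Finset.sum_congr rfl; intro j _; ring
  have h3 : ∑ i ∈ I, ∑ j ∈ I, M i j * (u i * y j) = ∑ i ∈ I, ∑ j ∈ I, M i j * (y i * u j) := by
    rw [Finset.sum_comm]
    apply Finset.sum_congr rfl; intro i _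
    apply Finset.sum_congr rfl; intro j _; rw [hs]; ring
  have h4 : 2 * t * ∑ i ∈ I, ∑ j ∈ I, M i j * (u i * y j) =
      t * ∑ i ∈ I, ∑ j ∈ I, M i j * (u i * y j) + t * ∑ i ∈ I, ∑ j ∈ I, M i j * (y i * u j) := by
    rw [h3]; ring
  rw [h1, h2, h4]
  simp only [Finset.mul_sum, ← Finset.sum_add_distrib]
  apply Finset.sum_congr rfl; intro i _
  apply Finset.sum_congr rfl; intro j _; ring

open Classical in
lemma rt_lagrangian {ι : Type*} (M : ι → ι → ℝ) (hs : ∀ i j, M i j = M j i)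
    (hd : ∀ i, M i i = 1) (h0 : ∀ i j, 0 ≤ M i j) (h1 : ∀ i j, M i j ≤ 1) (U : Finset ι)
    (H : ∀ I ⊆ U, ∀ x : ι → ℝ, (∀ i ∈ I, 0 ≤ x i) →
      (∀ i ∈ I, ∀ j ∈ I, i ≠ j → M i j < 1) →
      (∀ i ∈ I, ∑ j ∈ I, M i j * x j ≤ 1) → ∑ i ∈ I, x i ≤ 6) :
    ∀ I ⊆ U, ∀ x : ι → ℝ, (∀ i ∈ I, 0 ≤ x i) →
      (∑ i ∈ I, x i) ^ 2 ≤ 6 * ∑ i ∈ I, ∑ j ∈ I, M i j * (x i * x j) := by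
  intro I
  induction I using Finset.strongInduction with
  | H I ih =>
  intro hIU x hx
  -- reduction when a coordinate vanishes
  have red : ∀ z : ι → ℝ, (∀ i ∈ I, 0 ≤ z i) → (∃ j ∈ I, z j = 0) →
      (∑ i ∈ I, z i) ^ 2 ≤ 6 * ∑ i ∈ I, ∑ j ∈ I, M i j * (z i * z j) := by
    rintro z hz ⟨j, hj, hzj⟩
    have := ih (I.erase j) (Finset.erase_ssubset hj) ((Finset.erase_subset _ _).trans hIU) z
      (fun i hi => hz i (Finset.mem_of_mem_erase hi))
    rw [Finset.sum_erase _ hzj, Finset.sum_erase _ (by simp [hzj])] at this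
    refine this.trans (le_of_eq ?_)
    congr 1
    apply Finset.sum_congr rfl
    intro i _
    rw [Finset.sum_erase _ (by simp [hzj])]
  -- the simplex
  set K : Set (ι → ℝ) := {y | (∀ i, 0 ≤ y i) ∧ (∀ i, i ∉ I → y i = 0) ∧ ∑ i ∈ I, y i = 1} with hK
  have hKc : IsCompact K := by
    apply IsCompact.of_isClosed_subset
      (isCompact_univ_pi (fun _ : ι => isCompact_Icc (a := (0 : ℝ)) (b := 1)))
    · have e : K = (⋂ i, {y : ι → ℝ | 0 ≤ y i}) ∩ (⋂ i, {y : ι → ℝ | i ∉ I → y i = 0}) ∩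
          {y : ι → ℝ | ∑ i ∈ I, y i = 1} := by
        ext y; simp [hK, and_assoc]
      rw [e]
      refine IsClosed.inter (IsClosed.inter ?_ ?_) ?_
      · exact isClosed_iInter fun i => isClosed_le continuous_const (continuous_apply i)
      · refine isClosed_iInter fun i => ?_
        by_cases hi : i ∈ I
        · simp [hi]
        · simp only [hi, not_false_eq_true, true_imp_iff]
          exact isClosed_eq (continuous_apply i) continuous_const
      · exact isClosed_eq (by fun_prop) continuous_const
    · rintro y ⟨a, b, c⟩ i _
      refine ⟨a i, ?_⟩
      by_cases hi : i ∈ I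
      · rw [← c]
        exact Finset.single_le_sum (fun j _ => a j) hi
      · rw [b i hi]; norm_num
  set Q : (ι → ℝ) → ℝ := fun y => ∑ i ∈ I, ∑ j ∈ I, M i j * (y i * y j) with hQ
  have hQc : Continuous Q := by
    simp only [hQ]; fun_prop
  have main : ∀ y ∈ K, 1 ≤ 6 * Q y := by
    intro y0 hy0
    obtain ⟨y, hyK, hmin⟩ := hKc.exists_isMinOn ⟨y0, hy0⟩ hQc.continuousOn
    have hmin' : ∀ z ∈ K, Q y ≤ Q z := fun z hz => hmin hz
    suffices hsuff : 1 ≤ 6 * Q y by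
      have := hmin' y0 hy0; linarith
    obtain ⟨hy0', hyI, hy1⟩ := hyK
    by_cases hzero : ∃ j ∈ I, y j = 0
    · have := red y (fun i _ => hy0' i) hzero
      rw [hy1] at this
      simpa using this
    push Not at hzero
    have hpos : ∀ i ∈ I, 0 < y i := fun i hi => lt_of_le_of_ne (hy0' i) (hzero i hi).symm
    set g : ι → ℝ := fun i => ∑ j ∈ I, M i j * y j with hg
    -- moving weight from j to i
    have move : ∀ i ∈ I, ∀ j ∈ I, i ≠ j → ∀ t, 0 ≤ t → t ≤ y j →
        ∃ z ∈ K, (t = y j → z j = 0) ∧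
          Q z = Q y + 2 * t * (g i - g j) + t ^ 2 * (2 - 2 * M i j) := by
      intro i hi j hj hij t ht htj
      set u : ι → ℝ := fun k => (if k = i then 1 else 0) - (if k = j then 1 else 0) with hu
      refine ⟨fun k => y k + t * u k, ⟨?_, ?_, ?_⟩, ?_, ?_⟩
      · intro k
        have := hy0' k
        simp only [hu]
        by_cases a : k = i <;> by_cases b : k = j
        · exact absurd (a.symm.trans b) hij
        · simp [a, hij]; have := hy0' i; linarith
        · subst b; simp [a]; linarith
        · simp [a, b, this]
      · intro k hk
        have a : k ≠ i := by rintro rfl; exact hk hi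
        have b : k ≠ j := by rintro rfl; exact hk hj
        simp [hu, a, b, hyI k hk]
      · rw [Finset.sum_add_distrib, hy1, ← Finset.mul_sum]
        simp [hu, hi, hj]
      · intro h; simp [hu, hij.symm, h]
      · simp only [hQ]
        rw [rt_quad_line I M hs]
        have e1 : ∑ k ∈ I, u k * ∑ l ∈ I, M k l * y l = g i - g j := by
          simp [hu, sub_mul, hi, hj, hg]
        have e2 : ∀ k, ∑ l ∈ I, M k l * u l = M k i - M k j := by
          intro k
          simp [hu, mul_sub, hi, hj]
        have e3 : ∑ k ∈ I, u k * ∑ l ∈ I, M k l * u l = 2 - 2 * M i j := by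
          simp only [e2]
          simp [hu, sub_mul, hi, hj, hd]
          rw [hs j i]; ring
        rw [e1, e3]
    have hge : ∀ i ∈ I, ∀ j ∈ I, g j ≤ g i := by
      intro i hi j hj
      by_cases hij : i = j
      · rw [hij]
      by_contra hcon
      push Not at hcon
      set D := g j - g i with hD
      have hDpos : 0 < D := by simp only [hD]; linarith
      have hyj := hpos j hj
      obtain ⟨z, hzK, -, hzQ⟩ := move i hi j hj hij (min (y j) (D / 2)) (by positivity)
        (min_le_left _ _)
      set t := min (y j) (D / 2) with ht
      have htpos : 0 < t := by positivity
      have ht2 : t ≤ D / 2 := min_le_right _ _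
      have h3 := hmin' z hzK
      have h4 : g i - g j = -D := by simp only [hD]; ring
      rw [hzQ, h4] at h3
      have h5 : t ^ 2 * (2 - 2 * M i j) ≤ t ^ 2 * 2 := by
        apply mul_le_mul_of_nonneg_left _ (by positivity)
        linarith [h0 i j]
      have h6 : t * t ≤ t * (D / 2) := mul_le_mul_of_nonneg_left ht2 htpos.le
      have h7 : 0 < t * D := by positivity
      nlinarith
    have heq : ∀ i ∈ I, ∀ j ∈ I, g i = g j := fun i hi j hj =>
      le_antisymm (hge j hj i hi) (hge i hi j hj)
    by_cases hone : ∃ i ∈ I, ∃ j ∈ I, i ≠ j ∧ M i j = 1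
    · obtain ⟨i, hi, j, hj, hij, hM⟩ := hone
      obtain ⟨z, hzK, hz0, hzQ⟩ := move i hi j hj hij (y j) (hy0' j) le_rfl
      rw [hM, heq i hi j hj] at hzQ
      have h3 := red z (fun k _ => hzK.1 k) ⟨j, hj, hz0 rfl⟩
      rw [hzK.2.2] at h3
      have h4 : Q z = Q y := by rw [hzQ]; ring
      have h5 : (1 : ℝ) ^ 2 ≤ 6 * Q z := h3
      rw [h4] at h5
      simpa using h5
    · push Not at hone
      have hne : I.Nonempty := by
        by_contra hcon
        rw [Finset.not_nonempty_iff_eq_empty] at hcon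
        rw [hcon] at hy1
        simp at hy1
      obtain ⟨v, hv⟩ := hne
      have hQg : Q y = g v := by
        have : Q y = ∑ i ∈ I, y i * g i := by
          simp only [hQ, hg]
          apply Finset.sum_congr rfl; intro i _; rw [Finset.mul_sum]
          apply Finset.sum_congr rfl; intro j _; ring
        rw [this]
        calc ∑ i ∈ I, y i * g i = ∑ i ∈ I, y i * g v := by
              apply Finset.sum_congr rfl; intro i hi; rw [heq i hi v hv]
          _ = g v := by rw [← Finset.sum_mul, hy1, one_mul]
      have hgpos : 0 < g v := by
        have : M v v * y v ≤ g v := by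
          simp only [hg]
          exact Finset.single_le_sum (f := fun j => M v j * y j)
            (fun j _ => mul_nonneg (h0 v j) (hy0' j)) hv
        rw [hd, one_mul] at this
        exact lt_of_lt_of_le (hpos v hv) this
      have h3 := H I hIU (fun i => y i / g v) (fun i _ => div_nonneg (hy0' i) hgpos.le)
        (fun i hi j hj hij => lt_of_le_of_ne (h1 i j) (hone i hi j hj hij)) (by
          intro i hi
          have : ∑ j ∈ I, M i j * (y j / g v) = g i / g v := by
            simp only [hg, Finset.sum_div]
            apply Finset.sum_congr rfl; intro j _; ring
          rw [this, heq i hi v hv, div_self hgpos.ne'])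
      rw [← Finset.sum_div, hy1, div_le_iff₀ hgpos] at h3
      rw [hQg]; exact h3
  set σ := ∑ i ∈ I, x i with hσ
  have hσ0 : 0 ≤ σ := Finset.sum_nonneg hx
  rcases hσ0.eq_or_lt with h | h
  · rw [← h]
    have : 0 ≤ ∑ i ∈ I, ∑ j ∈ I, M i j * (x i * x j) :=
      Finset.sum_nonneg fun i hi => Finset.sum_nonneg fun j hj =>
        mul_nonneg (h0 i j) (mul_nonneg (hx i hi) (hx j hj))
    nlinarith
  · have h3 := main (fun i => if i ∈ I then x i / σ else 0) ⟨?_, ?_, ?_⟩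
    · have h4 : Q (fun i => if i ∈ I then x i / σ else 0) =
          (∑ i ∈ I, ∑ j ∈ I, M i j * (x i * x j)) / σ ^ 2 := by
        simp only [hQ, Finset.sum_div]
        apply Finset.sum_congr rfl; intro i hi
        apply Finset.sum_congr rfl; intro j hj
        simp only [hi, hj, if_true]
        field_simp
      rw [h4, ← mul_div_assoc, le_div_iff₀ (by positivity)] at h3
      linarith
    · intro i
      by_cases hi : i ∈ I
      · simp only [hi, if_true]; exact div_nonneg (hx i hi) hσ0
      · simp [hi]
    · intro i hi; simp [hi]
    · rw [Finset.sum_congr rfl (fun i hi => if_pos hi), ← Finset.sum_div, ← hσ, div_self h.ne']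

open Classical in
/-- the weighted Turan problem: the weight of a pair of clusters -/
noncomputable def rtW {ι : Type*} (isR : ι → Prop) (r b f : ι → ι → Prop) (i j : ι) : ℝ :=
  if i = j then 0 else
  if r i j ∨ (b i j ∧ (isR i ∨ isR j ∨ f i j)) then 1 else if b i j then 1 / 2 else 0

open Classical in
lemma rt_weighted {ι : Type*} (U : Finset ι) (x : ι → ℝ) (isR : ι → Prop)
    (r b f : ι → ι → Prop)
    (hx : ∀ i ∈ U, 0 ≤ x i)
    (hrs : ∀ i j, r i j → r j i) (hbs : ∀ i j, b i j → b j i) (hfs : ∀ i j, f i j → f j i)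
    (hfb : ∀ i j, f i j → b i j)
    (hrR : ∀ i ∈ U, ∀ j ∈ U, r i j → ¬ isR i ∧ ¬ isR j)
    (hr : ∀ i ∈ U, ∀ j ∈ U, ∀ k ∈ U, i ≠ j → i ≠ k → j ≠ k → r i j → r i k → r j k → False)
    (hST : ∀ S T : Finset ι, T ⊆ S → S ⊆ U → (S : Set ι).Pairwise b →
      (T : Set ι).Pairwise f → (∀ t ∈ T, ¬ isR t) → S.card + T.card ≠ 6) :
    ∑ i ∈ U, ∑ j ∈ U, rtW isR r b f i j * (x i * x j) ≤ 5 / 6 * (∑ i ∈ U, x i) ^ 2 := by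
  have key := rt_lagrangian (fun i j => 1 - rtW isR r b f i j) (by
      intro i j
      have e1 : r i j ↔ r j i := ⟨hrs _ _, hrs _ _⟩
      have e2 : b i j ↔ b j i := ⟨hbs _ _, hbs _ _⟩
      have e3 : f i j ↔ f j i := ⟨hfs _ _, hfs _ _⟩
      have e4 : (isR i ∨ isR j ∨ f i j) ↔ (isR j ∨ isR i ∨ f j i) := by rw [e3]; tauto
      simp only [rtW, e1, e2, e4, eq_comm (a := i) (b := j)])
    (by intro i; simp [rtW])
    (by intro i j; simp only [rtW]; split_ifs <;> norm_num)
    (by intro i j; simp only [rtW]; split_ifs <;> norm_num) U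
    (by
      intro I hI y hy hlt hle
      refine rt_complete I y isR r b f hy hrs hbs hfs hfb ?_
        (fun i hi j hj => hrR i (hI hi) j (hI hj))
        (fun i hi j hj k hk => hr i (hI hi) j (hI hj) k (hI hk))
        (fun S T hTS hSI => hST S T hTS (hSI.trans hI))
        (fun i j => ¬ isR i ∧ ¬ isR j ∧ b i j ∧ ¬ r i j ∧ ¬ f i j) (fun _ _ => Iff.rfl) ?_
      · intro i hi j hj hij
        have := hlt i hi j hj hij
        by_contra hcon
        push Not at hcon
        simp [rtW, hij, hcon.1, hcon.2] at this
      · intro i hi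
        refine le_trans ?_ (hle i hi)
        have e1 : y i = ∑ j ∈ I, if j = i then y j else 0 := by simp [hi]
        rw [Finset.sum_filter, Finset.mul_sum, e1, ← Finset.sum_add_distrib]
        apply Finset.sum_le_sum
        intro j hj
        have hyj := hy j hj
        by_cases hji : j = i
        · subst hji; simp [rtW]
        · have hij : ¬ i = j := fun h => hji h.symm
          have hw : rtW isR r b f i j ≤ 1 := by
            simp only [rtW]; split_ifs <;> norm_num
          simp only [hji, if_false, zero_add]
          split_ifs with h
          · obtain ⟨-, h2, h3, h4, h5, h6⟩ := h
            simp [rtW, hij, h2, h3, h4, h5, h6]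
            linarith
          · have : 0 ≤ (1 - rtW isR r b f i j) * y j := mul_nonneg (by linarith) hyj
            simpa using this)
    U subset_rfl x hx
  have e : ∑ i ∈ U, ∑ j ∈ U, (1 - rtW isR r b f i j) * (x i * x j) =
      (∑ i ∈ U, x i) ^ 2 - ∑ i ∈ U, ∑ j ∈ U, rtW isR r b f i j * (x i * x j) := by
    rw [sq, Finset.sum_mul_sum, ← Finset.sum_sub_distrib]
    apply Finset.sum_congr rfl; intro i _
    rw [← Finset.sum_sub_distrib]
    apply Finset.sum_congr rfl; intro j _; ring
  rw [e] at key
  linarith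

open Classical in
/-- conditional expectation with respect to a colouring of a finite set -/
noncomputable def rtP {Ω κ : Type*} [Fintype Ω] (C : Ω → κ) (g : Ω → ℝ) (w : Ω) : ℝ :=
  (∑ z with C z = C w, g z) / ((Finset.univ.filter fun z => C z = C w).card : ℝ)

lemma rtP_congr {Ω κ : Type*} [Fintype Ω] (C : Ω → κ) (g : Ω → ℝ) {w w' : Ω} (h : C w = C w') :
    rtP C g w = rtP C g w' := by
  unfold rtP
  rw [h]

open Classical in
lemma rtP_sum {Ω κ : Type*} [Fintype Ω] (C : Ω → κ) (g φ : Ω → ℝ)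
    (hφ : ∀ w w', C w = C w' → φ w = φ w') :
    ∑ w, φ w * rtP C g w = ∑ w, φ w * g w := by
  have h1 : ∀ w, φ w * rtP C g w = ∑ z, (if C z = C w then
      φ z * g z / ((Finset.univ.filter fun y => C y = C z).card : ℝ) else 0) := by
    intro w
    rw [rtP, Finset.sum_div, Finset.mul_sum, Finset.sum_filter]
    apply Finset.sum_congr rfl
    intro z _
    split_ifs with h
    · rw [hφ z w h, h]; ring
    · rfl
  simp only [h1]
  rw [Finset.sum_comm]
  apply Finset.sum_congr rfl
  intro z _
  rw [← Finset.sum_filter, Finset.sum_const]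
  have h2 : (Finset.univ.filter fun y => C z = C y) = Finset.univ.filter fun y => C y = C z := by
    ext y; simp [eq_comm]
  rw [h2, nsmul_eq_mul]
  have h3 : (0 : ℝ) < ((Finset.univ.filter fun y => C y = C z).card : ℝ) := by
    exact_mod_cast Finset.card_pos.2 ⟨z, by simp⟩
  field_simp

lemma rtP_pyth {Ω κ κ' : Type*} [Fintype Ω] (C : Ω → κ) (D : Ω → κ') (g : Ω → ℝ)
    (h : ∀ w w', D w = D w' → C w = C w') :
    ∑ w, (rtP D g w - rtP C g w) ^ 2 = ∑ w, rtP D g w ^ 2 - ∑ w, rtP C g w ^ 2 := by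
  have h1 := rtP_sum D g (rtP C g) (fun w w' hw => rtP_congr C g (h w w' hw))
  have h2 := rtP_sum C g (rtP C g) (fun w w' hw => rtP_congr C g hw)
  have h3 : ∑ w, (rtP D g w - rtP C g w) ^ 2 =
      ∑ w, rtP D g w ^ 2 - 2 * ∑ w, rtP C g w * rtP D g w + ∑ w, rtP C g w * rtP C g w := by
    rw [Finset.mul_sum, ← Finset.sum_sub_distrib, ← Finset.sum_add_distrib]
    apply Finset.sum_congr rfl; intro w _; ring
  have h4 : ∑ w, rtP C g w ^ 2 = ∑ w, rtP C g w * rtP C g w := by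
    apply Finset.sum_congr rfl; intro w _; ring
  rw [h3, h4, h1, h2]; ring

lemma rtP_bound {Ω κ : Type*} [Fintype Ω] (C : Ω → κ) (g : Ω → ℝ) (h0 : ∀ w, 0 ≤ g w)
    (h1 : ∀ w, g w ≤ 1) (w : Ω) : 0 ≤ rtP C g w ∧ rtP C g w ≤ 1 := by
  classical
  constructor
  · exact div_nonneg (Finset.sum_nonneg fun z _ => h0 z) (by positivity)
  · apply div_le_one_of_le₀ _ (by positivity)
    calc _ ≤ ∑ z with C z = C w, (1 : ℝ) := Finset.sum_le_sum fun z _ => h1 z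
      _ = _ := by simp

/-- sum of the values of `g` over a box -/
def rtE {V : Type*} (g : V → V → ℝ) (A B : Finset V) : ℝ := ∑ u ∈ A, ∑ v ∈ B, g u v

open Classical in
/-- colour class -/
noncomputable def rtCls {V κ : Type*} [Fintype V] (c : V → κ) (i : κ) : Finset V :=
  Finset.univ.filter fun v => c v = i

lemma rtCls_mem {V κ : Type*} [Fintype V] (c : V → κ) (i : κ) (v : V) :
    v ∈ rtCls c i ↔ c v = i := by simp [rtCls]

/-- density of a pair of classes -/
noncomputable def rtD {V κ : Type*} [Fintype V] (g : V → V → ℝ) (c : V → κ) (i j : κ) : ℝ :=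
  rtE g (rtCls c i) (rtCls c j) / ((rtCls c i).card * (rtCls c j).card)

lemma rtP_prod {V κ : Type*} [Fintype V] (g : V → V → ℝ) (c : V → κ) (u v : V) :
    rtP (fun p : V × V => (c p.1, c p.2)) (fun p => g p.1 p.2) (u, v) = rtD g c (c u) (c v) := by
  classical
  have h : (Finset.univ.filter fun z : V × V => (c z.1, c z.2) = (c u, c v)) =
      rtCls c (c u) ×ˢ rtCls c (c v) := by
    ext ⟨a, b⟩
    simp [rtCls_mem]
  simp only [rtP, rtD, rtE]
  rw [← Finset.sum_product', ← Nat.cast_mul, ← Finset.card_product]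
  congr 1
  · apply Finset.sum_congr _ (fun _ _ => rfl)
    convert h using 2
  · congr 2

/-- a pair of classes that fails to be lower regular -/
def rtIrr {V κ : Type*} [Fintype V] (g : V → V → ℝ) (c : V → κ) (ε : ℝ) (i j : κ) : Prop :=
  ∃ A B : Finset V, A ⊆ rtCls c i ∧ B ⊆ rtCls c j ∧ ε * (rtCls c i).card ≤ A.card ∧
    ε * (rtCls c j).card ≤ B.card ∧ rtE g A B < (rtD g c i j - ε) * (A.card * B.card)

open Classical in
/-- total mass of the irregular pairs -/
noncomputable def rtMass {V κ : Type*} [Fintype V] [Fintype κ] (g : V → V → ℝ) (c : V → κ)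
    (ε : ℝ) : ℝ :=
  ∑ p : κ × κ with rtIrr g c ε p.1 p.2, ((rtCls c p.1).card * (rtCls c p.2).card : ℝ)

/-- energy of a colouring -/
noncomputable def rtEn {V κ : Type*} [Fintype V] (g : V → V → ℝ) (c : V → κ) : ℝ :=
  ∑ w : V × V, rtP (fun p : V × V => (c p.1, c p.2)) (fun p => g p.1 p.2) w ^ 2

lemma rtEn_nonneg {V κ : Type*} [Fintype V] (g : V → V → ℝ) (c : V → κ) : 0 ≤ rtEn g c :=
  Finset.sum_nonneg fun _ _ => sq_nonneg _

lemma rtEn_le {V κ : Type*} [Fintype V] (g : V → V → ℝ) (c : V → κ) (h0 : ∀ u v, 0 ≤ g u v)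
    (h1 : ∀ u v, g u v ≤ 1) : rtEn g c ≤ (Fintype.card V : ℝ) ^ 2 := by
  have : rtEn g c ≤ ∑ w : V × V, (1 : ℝ) := by
    apply Finset.sum_le_sum
    intro w _
    have := rtP_bound (fun p : V × V => (c p.1, c p.2)) (fun p => g p.1 p.2)
      (fun w => h0 _ _) (fun w => h1 _ _) w
    exact pow_le_one₀ this.1 this.2
  simpa [sq] using this

lemma rtEn_mono {V κ κ' : Type*} [Fintype V] (g : V → V → ℝ) (c : V → κ) (c' : V → κ')
    (h : ∀ u v, c' u = c' v → c u = c v) : rtEn g c ≤ rtEn g c' := by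
  have h1 := rtP_pyth (fun p : V × V => (c p.1, c p.2)) (fun p : V × V => (c' p.1, c' p.2))
    (fun p => g p.1 p.2) (by
      rintro ⟨a, b⟩ ⟨a', b'⟩ hh
      simp only [Prod.mk.injEq] at hh ⊢
      exact ⟨h _ _ hh.1, h _ _ hh.2⟩)
  have h2 : 0 ≤ rtEn g c' - rtEn g c := by
    rw [rtEn, rtEn, ← h1]
    exact Finset.sum_nonneg fun _ _ => sq_nonneg _
  linarith

lemma rtEn_incr {V κ κ' : Type*} [Fintype V] [Fintype κ] (g : V → V → ℝ) (c : V → κ)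
    (c' : V → κ') (h : ∀ u v, c' u = c' v → c u = c v) (ε : ℝ) (hε : 0 < ε)
    (A B : κ → κ → Finset V)
    (hAB : ∀ i j, rtIrr g c ε i j → A i j ⊆ rtCls c i ∧ B i j ⊆ rtCls c j ∧
      ε * (rtCls c i).card ≤ (A i j).card ∧ ε * (rtCls c j).card ≤ (B i j).card ∧
      rtE g (A i j) (B i j) < (rtD g c i j - ε) * ((A i j).card * (B i j).card))
    (hA : ∀ i j u v, c' u = c' v → (u ∈ A i j ↔ v ∈ A i j))
    (hB : ∀ i j u v, c' u = c' v → (u ∈ B i j ↔ v ∈ B i j)) :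
    rtEn g c + ε ^ 4 * rtMass g c ε ≤ rtEn g c' := by
  classical
  set C : V × V → κ × κ := fun p => (c p.1, c p.2) with hC
  set D : V × V → κ' × κ' := fun p => (c' p.1, c' p.2) with hD
  set G : V × V → ℝ := fun p => g p.1 p.2 with hG
  have hpy := rtP_pyth C D G (by
      rintro ⟨a, b⟩ ⟨a', b'⟩ hh
      simp only [hC, hD, Prod.mk.injEq] at hh ⊢
      exact ⟨h _ _ hh.1, h _ _ hh.2⟩)
  have e0 : rtEn g c' - rtEn g c = ∑ w, (rtP D G w - rtP C G w) ^ 2 := by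
    rw [hpy]; rfl
  set F : V × V → ℝ := fun w => (rtP D G w - rtP C G w) ^ 2 with hF
  -- each irregular pair contributes
  have hpair : ∀ i j, rtIrr g c ε i j →
      ε ^ 4 * ((rtCls c i).card * (rtCls c j).card) ≤ ∑ w ∈ A i j ×ˢ B i j, F w := by
    intro i j hij
    obtain ⟨h1, h2, h3, h4, h5⟩ := hAB i j hij
    set a : ℝ := ((A i j).card : ℝ) with ha
    set b : ℝ := ((B i j).card : ℝ) with hb
    have ha0 : 0 ≤ a := by simp [ha]
    have hb0 : 0 ≤ b := by simp [hb]
    have s1 : ∑ w ∈ A i j ×ˢ B i j, rtP D G w = rtE g (A i j) (B i j) := by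
      have := rtP_sum D G (fun w => if w ∈ A i j ×ˢ B i j then 1 else 0) (by
        rintro ⟨u, v⟩ ⟨u', v'⟩ hh
        simp only [hD, Prod.mk.injEq] at hh
        simp only [Finset.mem_product, hA i j u u' hh.1, hB i j v v' hh.2])
      simp only [ite_mul, one_mul, zero_mul, ← Finset.sum_filter, Finset.filter_univ_mem] at this
      rw [this, rtE, Finset.sum_product]
    have s2 : ∑ w ∈ A i j ×ˢ B i j, rtP C G w = rtD g c i j * (a * b) := by
      have : ∀ w ∈ A i j ×ˢ B i j, rtP C G w = rtD g c i j := by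
        rintro ⟨u, v⟩ hw
        rw [Finset.mem_product] at hw
        rw [hC, hG, rtP_prod, (rtCls_mem c i u).1 (h1 hw.1), (rtCls_mem c j v).1 (h2 hw.2)]
      rw [Finset.sum_congr rfl this, Finset.sum_const, Finset.card_product, nsmul_eq_mul,
        Nat.cast_mul, mul_comm]
    have s3 : ∑ w ∈ A i j ×ˢ B i j, (rtP D G w - rtP C G w) < - (ε * (a * b)) := by
      rw [Finset.sum_sub_distrib, s1, s2]; linarith
    have s4 : (∑ w ∈ A i j ×ˢ B i j, (rtP D G w - rtP C G w)) ^ 2 ≤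
        (a * b) * ∑ w ∈ A i j ×ˢ B i j, F w := by
      have := sq_sum_le_card_mul_sum_sq (s := A i j ×ˢ B i j) (f := fun w => rtP D G w - rtP C G w)
      rw [Finset.card_product, Nat.cast_mul] at this
      exact this
    have hab : 0 ≤ a * b := by positivity
    have hS0 : 0 ≤ ∑ w ∈ A i j ×ˢ B i j, F w := Finset.sum_nonneg fun _ _ => sq_nonneg _
    have s5 : ε ^ 2 * (a * b) ≤ ∑ w ∈ A i j ×ˢ B i j, F w := by
      rcases hab.eq_or_lt with h0 | h0
      · rw [← h0]; simpa using hS0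
      · have s6 : (ε * (a * b)) ^ 2 ≤ (a * b) * ∑ w ∈ A i j ×ˢ B i j, F w := by
          refine le_trans ?_ s4
          have : 0 ≤ ε * (a * b) := by positivity
          nlinarith
        have s7 : (a * b) * (ε ^ 2 * (a * b)) ≤ (a * b) * ∑ w ∈ A i j ×ˢ B i j, F w := by
          refine le_trans (le_of_eq ?_) s6; ring
        exact le_of_mul_le_mul_left s7 h0
    refine le_trans ?_ s5
    have s8 : (ε * (rtCls c i).card) * (ε * (rtCls c j).card) ≤ a * b :=
      mul_le_mul h3 h4 (by positivity) ha0
    calc ε ^ 4 * ((rtCls c i).card * (rtCls c j).card)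
        = ε ^ 2 * ((ε * (rtCls c i).card) * (ε * (rtCls c j).card)) := by ring
      _ ≤ ε ^ 2 * (a * b) := mul_le_mul_of_nonneg_left s8 (by positivity)
  have htot : ε ^ 4 * rtMass g c ε ≤ ∑ w, F w := by
    rw [rtMass, Finset.mul_sum]
    calc _ ≤ ∑ p : κ × κ with rtIrr g c ε p.1 p.2, ∑ w with C w = p, F w := by
          apply Finset.sum_le_sum
          rintro ⟨i, j⟩ hp
          have hp' : rtIrr g c ε i j := (Finset.mem_filter.1 hp).2
          refine (hpair i j hp').trans ?_
          apply Finset.sum_le_sum_of_subset_of_nonneg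
          · rintro ⟨u, v⟩ hw
            rw [Finset.mem_product] at hw
            obtain ⟨h1, h2, -⟩ := hAB i j hp'
            simp [hC, (rtCls_mem c i u).1 (h1 hw.1), (rtCls_mem c j v).1 (h2 hw.2)]
          · intro _ _ _; exact sq_nonneg _
      _ ≤ ∑ p : κ × κ, ∑ w with C w = p, F w := by
          apply Finset.sum_le_sum_of_subset_of_nonneg (Finset.filter_subset _ _)
          intro p _ _
          exact Finset.sum_nonneg fun _ _ => sq_nonneg _
      _ = ∑ w, F w := Finset.sum_fiberwise _ _ _
  linarith

/-- one refinement step for two functions -/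
lemma rt_refine {V κ : Type} [Fintype V] [Fintype κ] (g₁ g₂ : V → V → ℝ) (c : V → κ)
    (ε : ℝ) (hε : 0 < ε) :
    ∃ (κ' : Type) (_ : Fintype κ') (c' : V → κ'),
      Fintype.card κ' = Fintype.card κ * 2 ^ (Fintype.card κ * Fintype.card κ * 4) ∧
      (∀ u v, c' u = c' v → c u = c v) ∧
      rtEn g₁ c + ε ^ 4 * rtMass g₁ c ε ≤ rtEn g₁ c' ∧
      rtEn g₂ c + ε ^ 4 * rtMass g₂ c ε ≤ rtEn g₂ c' := by
  classical
  have hch : ∀ g : V → V → ℝ, ∃ A B : κ → κ → Finset V, ∀ i j, rtIrr g c ε i j →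
      A i j ⊆ rtCls c i ∧ B i j ⊆ rtCls c j ∧
      ε * (rtCls c i).card ≤ (A i j).card ∧ ε * (rtCls c j).card ≤ (B i j).card ∧
      rtE g (A i j) (B i j) < (rtD g c i j - ε) * ((A i j).card * (B i j).card) := by
    intro g
    have : ∀ i j, ∃ A B : Finset V, rtIrr g c ε i j →
      A ⊆ rtCls c i ∧ B ⊆ rtCls c j ∧
      ε * (rtCls c i).card ≤ A.card ∧ ε * (rtCls c j).card ≤ B.card ∧
      rtE g A B < (rtD g c i j - ε) * (A.card * B.card) := by
      intro i j
      by_cases h : rtIrr g c ε i j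
      · obtain ⟨A, B, h'⟩ := h
        exact ⟨A, B, fun _ => h'⟩
      · exact ⟨∅, ∅, fun h' => absurd h' h⟩
    choose A B hAB using this
    exact ⟨A, B, hAB⟩
  obtain ⟨A₁, B₁, h₁⟩ := hch g₁
  obtain ⟨A₂, B₂, h₂⟩ := hch g₂
  let c' : V → κ × (κ × κ × Fin 4 → Bool) := fun u => (c u, fun p =>
    if p.2.2 = 0 then decide (u ∈ A₁ p.1 p.2.1) else
    if p.2.2 = 1 then decide (u ∈ B₁ p.1 p.2.1) else
    if p.2.2 = 2 then decide (u ∈ A₂ p.1 p.2.1) else decide (u ∈ B₂ p.1 p.2.1))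
  have hc' : ∀ u v, c' u = c' v → c u = c v := fun u v h => congrArg Prod.fst h
  have hk : ∀ (k : Fin 4) (i j : κ) u v, c' u = c' v → (c' u).2 (i, j, k) = (c' v).2 (i, j, k) := by
    intro k i j u v h; rw [h]
  refine ⟨_, inferInstance, c', ?_, hc', ?_, ?_⟩
  · simp [mul_assoc]
  · refine rtEn_incr g₁ c c' hc' ε hε A₁ B₁ h₁ ?_ ?_
    · intro i j u v h
      have := hk 0 i j u v h
      simpa [c'] using this
    · intro i j u v h
      have := hk 1 i j u v h
      simpa [c'] using this
  · refine rtEn_incr g₂ c c' hc' ε hε A₂ B₂ h₂ ?_ ?_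
    · intro i j u v h
      have := hk 2 i j u v h
      simpa [c'] using this
    · intro i j u v h
      have := hk 3 i j u v h
      simpa [c'] using this

lemma rtMass_nonneg {V κ : Type*} [Fintype V] [Fintype κ] (g : V → V → ℝ) (c : V → κ)
    (ε : ℝ) : 0 ≤ rtMass g c ε :=
  Finset.sum_nonneg fun _ _ => by positivity

lemma rt_regularity_aux (ε : ℝ) (hε : 0 < ε) (t : ℕ) : ∀ k : ℕ, ∃ K : ℕ,
    ∀ (V : Type) [Fintype V] (g₁ g₂ : V → V → ℝ), (∀ u v, 0 ≤ g₁ u v) → (∀ u v, g₁ u v ≤ 1) →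
      (∀ u v, 0 ≤ g₂ u v) → (∀ u v, g₂ u v ≤ 1) →
      ∀ (κ : Type) [Fintype κ] (c : V → κ), Fintype.card κ ≤ k →
      (2 - t * ε ^ 5) * (Fintype.card V : ℝ) ^ 2 ≤ rtEn g₁ c + rtEn g₂ c →
      ∃ (κ' : Type) (_ : Fintype κ') (c' : V → κ'), Fintype.card κ' ≤ K ∧
        (∀ u v, c' u = c' v → c u = c v) ∧
        rtMass g₁ c' ε ≤ ε * (Fintype.card V : ℝ) ^ 2 ∧
        rtMass g₂ c' ε ≤ ε * (Fintype.card V : ℝ) ^ 2 := by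
  induction t with
  | zero =>
    intro k
    refine ⟨k, ?_⟩
    intro V _ g₁ g₂ h10 h11 h20 h21 κ _ c hk hE
    refine ⟨κ, inferInstance, c, hk, fun _ _ h => h, ?_⟩
    obtain ⟨κ', _, c', -, -, e1, e2⟩ := rt_refine g₁ g₂ c ε hε
    have b1 := rtEn_le g₁ c' h10 h11
    have b2 := rtEn_le g₂ c' h20 h21
    have m1 := rtMass_nonneg g₁ c ε
    have m2 := rtMass_nonneg g₂ c ε
    have h4 : 0 < ε ^ 4 := by positivity
    have hn : 0 ≤ ε * (Fintype.card V : ℝ) ^ 2 := by positivity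
    have p1 : 0 ≤ ε ^ 4 * rtMass g₁ c ε := by positivity
    have p2 : 0 ≤ ε ^ 4 * rtMass g₂ c ε := by positivity
    simp only [Nat.cast_zero, zero_mul, sub_zero] at hE
    constructor
    · have : ε ^ 4 * rtMass g₁ c ε ≤ 0 := by linarith
      have : rtMass g₁ c ε ≤ 0 := by
        by_contra hcon; push Not at hcon
        have : 0 < ε ^ 4 * rtMass g₁ c ε := by positivity
        linarith
      linarith
    · have : ε ^ 4 * rtMass g₂ c ε ≤ 0 := by linarith
      have : rtMass g₂ c ε ≤ 0 := by
        by_contra hcon; push Not at hcon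
        have : 0 < ε ^ 4 * rtMass g₂ c ε := by positivity
        linarith
      linarith
  | succ t ih =>
    intro k
    obtain ⟨K, hK⟩ := ih (k * 2 ^ (k * k * 4))
    refine ⟨max k K, ?_⟩
    intro V _ g₁ g₂ h10 h11 h20 h21 κ _ c hk hE
    by_cases hgood : rtMass g₁ c ε ≤ ε * (Fintype.card V : ℝ) ^ 2 ∧
        rtMass g₂ c ε ≤ ε * (Fintype.card V : ℝ) ^ 2
    · exact ⟨κ, inferInstance, c, hk.trans (le_max_left _ _), fun _ _ h => h, hgood⟩
    obtain ⟨κ', _, c', hcard, href, e1, e2⟩ := rt_refine g₁ g₂ c ε hε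
    have m1 := rtMass_nonneg g₁ c ε
    have m2 := rtMass_nonneg g₂ c ε
    have h4 : 0 < ε ^ 4 := by positivity
    have p1 : 0 ≤ ε ^ 4 * rtMass g₁ c ε := by positivity
    have p2 : 0 ≤ ε ^ 4 * rtMass g₂ c ε := by positivity
    have hinc : ε ^ 5 * (Fintype.card V : ℝ) ^ 2 ≤
        ε ^ 4 * rtMass g₁ c ε + ε ^ 4 * rtMass g₂ c ε := by
      have e : ε ^ 5 * (Fintype.card V : ℝ) ^ 2 = ε ^ 4 * (ε * (Fintype.card V : ℝ) ^ 2) := by ring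
      rw [not_and_or] at hgood
      rcases hgood with h | h <;> push Not at h
      · have := mul_le_mul_of_nonneg_left h.le h4.le
        linarith
      · have := mul_le_mul_of_nonneg_left h.le h4.le
        linarith
    have hcard' : Fintype.card κ' ≤ k * 2 ^ (k * k * 4) := by
      rw [hcard]
      exact Nat.mul_le_mul hk (Nat.pow_le_pow_right (by norm_num)
        (Nat.mul_le_mul_right _ (Nat.mul_le_mul hk hk)))
    push_cast at hE
    obtain ⟨κ'', i2, c'', a1, a2, a3⟩ := hK V g₁ g₂ h10 h11 h20 h21 κ' c' hcard' (by linarith)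
    exact ⟨κ'', i2, c'', a1.trans (le_max_right _ _), fun u v h => href u v (a2 u v h), a3⟩

/-- a regularity lemma for two functions, refining a given partition -/
lemma rt_regularity (ε : ℝ) (hε : 0 < ε) (k : ℕ) : ∃ K : ℕ,
    ∀ (V : Type) [Fintype V] (g₁ g₂ : V → V → ℝ), (∀ u v, 0 ≤ g₁ u v) → (∀ u v, g₁ u v ≤ 1) →
      (∀ u v, 0 ≤ g₂ u v) → (∀ u v, g₂ u v ≤ 1) →
      ∀ (κ : Type) [Fintype κ] (c : V → κ), Fintype.card κ ≤ k →
      ∃ (κ' : Type) (_ : Fintype κ') (c' : V → κ'), Fintype.card κ' ≤ K ∧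
        (∀ u v, c' u = c' v → c u = c v) ∧
        rtMass g₁ c' ε ≤ ε * (Fintype.card V : ℝ) ^ 2 ∧
        rtMass g₂ c' ε ≤ ε * (Fintype.card V : ℝ) ^ 2 := by
  obtain ⟨t, ht⟩ := exists_nat_ge (2 / ε ^ 5)
  obtain ⟨K, hK⟩ := rt_regularity_aux ε hε t k
  refine ⟨K, ?_⟩
  intro V _ g₁ g₂ h10 h11 h20 h21 κ _ c hk
  refine hK V g₁ g₂ h10 h11 h20 h21 κ c hk ?_
  have h5 : 0 < ε ^ 5 := by positivity
  rw [div_le_iff₀ h5] at ht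
  have h1 := rtEn_nonneg g₁ c
  have h2 := rtEn_nonneg g₂ c
  have h3 : (2 - t * ε ^ 5) * (Fintype.card V : ℝ) ^ 2 ≤ 0 :=
    mul_nonpos_of_nonpos_of_nonneg (by linarith) (by positivity)
  linarith

open Classical in
/-- indicator function of a graph -/
noncomputable def rtI {V : Type*} (g : SimpleGraph V) (u v : V) : ℝ := if g.Adj u v then 1 else 0

/-- lower regularity of a pair of sets -/
def rtLow {V : Type*} (g : SimpleGraph V) (X Y : Finset V) (p q d : ℝ) : Prop :=
  ∀ A B : Finset V, A ⊆ X → B ⊆ Y → p ≤ A.card → q ≤ B.card →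
    d * (A.card * B.card) ≤ rtE (rtI g) A B

lemma rtLow_mono {V : Type*} {g : SimpleGraph V} {X Y X' Y' : Finset V} {p q d : ℝ}
    (h : rtLow g X Y p q d) (hX : X' ⊆ X) (hY : Y' ⊆ Y) : rtLow g X' Y' p q d :=
  fun A B hA hB => h A B (hA.trans hX) (hB.trans hY)

open Classical in
lemma rtE_rtI {V : Type*} (g : SimpleGraph V) (A B : Finset V) :
    rtE (rtI g) A B = ∑ u ∈ A, ((B.filter (g.Adj u)).card : ℝ) := by
  unfold rtE rtI
  apply Finset.sum_congr rfl
  intro u _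
  rw [Finset.sum_boole]

open Classical in
lemma rt_bad {V : Type*} (g : SimpleGraph V) (X Y : Finset V) (p q d : ℝ) (hp : 0 < p)
    (h : rtLow g X Y p q d) (hq : q ≤ Y.card) :
    ((X.filter fun v => ((Y.filter (g.Adj v)).card : ℝ) < d * Y.card).card : ℝ) < p := by
  by_contra hcon
  push Not at hcon
  set B := X.filter fun v => ((Y.filter (g.Adj v)).card : ℝ) < d * Y.card with hB
  have h1 := h B Y (Finset.filter_subset _ _) subset_rfl hcon hq
  rw [rtE_rtI] at h1
  have hne : B.Nonempty := by
    rw [← Finset.card_pos]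
    have : (0 : ℝ) < B.card := lt_of_lt_of_le hp hcon
    exact_mod_cast this
  have h2 : ∑ u ∈ B, ((Y.filter (g.Adj u)).card : ℝ) < ∑ u ∈ B, d * Y.card :=
    Finset.sum_lt_sum_of_nonempty hne fun u hu => (Finset.mem_filter.1 hu).2
  rw [Finset.sum_const, nsmul_eq_mul] at h2
  nlinarith

open Classical in
lemma rt_pick {V ι : Type*} (g : SimpleGraph V) (X : Finset V) (J : Finset ι)
    (Y : ι → Finset V) (p : ℝ) (q d : ι → ℝ) (hp : 0 < p)
    (h : ∀ j ∈ J, rtLow g X (Y j) p (q j) (d j)) (hq : ∀ j ∈ J, q j ≤ (Y j).card)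
    (hX : (J.card + 1) * p ≤ X.card) :
    ∃ X' ⊆ X, p ≤ X'.card ∧ ∀ v ∈ X', ∀ j ∈ J,
      d j * (Y j).card ≤ (((Y j).filter (g.Adj v)).card : ℝ) := by
  set bad : ι → Finset V := fun j =>
    X.filter fun v => (((Y j).filter (g.Adj v)).card : ℝ) < d j * (Y j).card with hbad
  refine ⟨X \ J.biUnion bad, Finset.sdiff_subset, ?_, ?_⟩
  · have h1 : (((J.biUnion bad)).card : ℝ) ≤ J.card * p := by
      calc (((J.biUnion bad)).card : ℝ) ≤ ∑ j ∈ J, ((bad j).card : ℝ) := by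
            exact_mod_cast Finset.card_biUnion_le
        _ ≤ ∑ j ∈ J, p := Finset.sum_le_sum fun j hj =>
            (rt_bad g X (Y j) p (q j) (d j) hp (h j hj) (hq j hj)).le
        _ = _ := by rw [Finset.sum_const, nsmul_eq_mul]
    have h2 : (X.card : ℝ) ≤ (X \ J.biUnion bad).card + (J.biUnion bad).card := by
      have := Finset.le_card_sdiff (J.biUnion bad) X
      have : X.card ≤ (X \ J.biUnion bad).card + (J.biUnion bad).card := by omega
      exact_mod_cast this
    linarith
  · intro v hv j hj
    rw [Finset.mem_sdiff, Finset.mem_biUnion] at hv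
    by_contra hcon
    push Not at hcon
    exact hv.2 ⟨j, hj, Finset.mem_filter.2 ⟨hv.1, hcon⟩⟩

open Classical in
lemma rt_embedT {V ι : Type*} (g : SimpleGraph V) (η : ℝ) (hη : 0 < η) (hη1 : η ≤ 1)
    (p : ι → ℝ) (hp : ∀ t, 0 < p t) (T : Finset ι) : ∀ X : ι → Finset V,
    (∀ s ∈ T, ∀ t ∈ T, s ≠ t → rtLow g (X s) (X t) (p s) (p t) (1 / 2 + η)) →
    (∀ t ∈ T, ∀ A ⊆ X t, p t ≤ A.card → ∃ u ∈ A, ∃ v ∈ A, g.Adj u v) →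
    (∀ t ∈ T, 6 * p t ≤ η ^ T.card * (X t).card) → T.card ≤ 6 →
    ∃ Q : Finset V, g.IsNClique (2 * T.card) Q ∧ ∀ q ∈ Q, ∃ t ∈ T, q ∈ X t := by
  induction T using Finset.induction_on with
  | empty =>
    intro X _ _ _ _
    exact ⟨∅, by simp [SimpleGraph.isNClique_iff], by simp⟩
  | insert a T ha ih =>
    intro X hlow hedge hbig hcard
    rw [Finset.card_insert_of_notMem ha] at hcard hbig
    have hle : ∀ t ∈ insert a T, 6 * p t ≤ (X t).card := by
      intro t ht
      refine (hbig t ht).trans ?_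
      have : η ^ (T.card + 1) ≤ 1 := pow_le_one₀ hη.le hη1
      nlinarith [Nat.cast_nonneg (α := ℝ) (X t).card]
    have hne : ∀ t ∈ T, a ≠ t := by
      rintro t ht rfl; exact ha ht
    obtain ⟨X', hX', hpX', hgood⟩ := rt_pick g (X a) T X (p a) p (fun _ => 1 / 2 + η) (hp a)
      (fun j hj => hlow a (Finset.mem_insert_self _ _) j (Finset.mem_insert_of_mem hj) (hne j hj))
      (fun j hj => by
        have := hle j (Finset.mem_insert_of_mem hj)
        have := hp j
        linarith)
      (by
        have h1 := hle a (Finset.mem_insert_self _ _)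
        have h2 : (T.card : ℝ) + 1 ≤ 6 := by exact_mod_cast hcard
        have := hp a
        nlinarith)
    obtain ⟨u, hu, v, hv, huv⟩ := hedge a (Finset.mem_insert_self _ _) X' hX' hpX'
    set Z : ι → Finset V := fun t => (X t).filter fun w => g.Adj u w ∧ g.Adj v w with hZ
    have hZX : ∀ t, Z t ⊆ X t := fun t => Finset.filter_subset _ _
    have hZcard : ∀ t ∈ T, η * (X t).card ≤ (Z t).card := by
      intro t ht
      have h1 := hgood u hu t ht
      have h2 := hgood v hv t ht
      have h3 : ((X t).filter (g.Adj u)).card + ((X t).filter (g.Adj v)).card ≤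
          (X t).card + (Z t).card := by
        rw [← Finset.card_union_add_card_inter, ← Finset.filter_and]
        exact Nat.add_le_add_right (Finset.card_le_card
          (Finset.union_subset (Finset.filter_subset _ _) (Finset.filter_subset _ _))) _
      have h3' : (((X t).filter (g.Adj u)).card : ℝ) + ((X t).filter (g.Adj v)).card ≤
          (X t).card + (Z t).card := by exact_mod_cast h3
      have : 0 ≤ η * (X t).card := by positivity
      linarith
    obtain ⟨Q, hQ, hQX⟩ := ih Z
      (fun s hs t ht hst => rtLow_mono (hlow s (Finset.mem_insert_of_mem hs) t
        (Finset.mem_insert_of_mem ht) hst) (hZX s) (hZX t))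
      (fun t ht A hA => hedge t (Finset.mem_insert_of_mem ht) A (hA.trans (hZX t)))
      (fun t ht => by
        refine (hbig t (Finset.mem_insert_of_mem ht)).trans ?_
        rw [pow_succ, mul_assoc]
        exact mul_le_mul_of_nonneg_left (hZcard t ht) (by positivity))
      (by omega)
    have hQ' : ∀ q ∈ Q, g.Adj u q ∧ g.Adj v q := by
      intro q hq
      obtain ⟨t, _, ht⟩ := hQX q hq
      exact (Finset.mem_filter.1 ht).2
    refine ⟨insert u (insert v Q), ?_, ?_⟩
    · rw [Finset.card_insert_of_notMem ha]
      have h1 := hQ.insert (fun b hb => (hQ' b hb).2)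
      have h2 := h1.insert (a := u) (by
        intro b hb
        rcases Finset.mem_insert.1 hb with rfl | hb
        · exact huv
        · exact (hQ' b hb).1)
      exact h2
    · intro q hq
      rcases Finset.mem_insert.1 hq with rfl | hq
      · exact ⟨a, Finset.mem_insert_self _ _, hX' hu⟩
      rcases Finset.mem_insert.1 hq with rfl | hq
      · exact ⟨a, Finset.mem_insert_self _ _, hX' hv⟩
      · obtain ⟨t, ht, ht'⟩ := hQX q hq
        exact ⟨t, Finset.mem_insert_of_mem ht, hZX t ht'⟩

open Classical in
lemma rt_embedS {V ι : Type*} (g : SimpleGraph V) (η : ℝ) (hη : 0 < η) (hη1 : η ≤ 1)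
    (p : ι → ℝ) (hp : ∀ t, 0 < p t) (T : Finset ι) (U : Finset ι) (hd : Disjoint U T) :
    ∀ X : ι → Finset V,
    (∀ s ∈ U ∪ T, ∀ t ∈ U ∪ T, s ≠ t → rtLow g (X s) (X t) (p s) (p t) η) →
    (∀ s ∈ T, ∀ t ∈ T, s ≠ t → rtLow g (X s) (X t) (p s) (p t) (1 / 2 + η)) →
    (∀ t ∈ T, ∀ A ⊆ X t, p t ≤ A.card → ∃ u ∈ A, ∃ v ∈ A, g.Adj u v) →
    (∀ t ∈ U ∪ T, 6 * p t ≤ η ^ (U.card + T.card) * (X t).card) → U.card + T.card ≤ 6 →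
    ∃ Q : Finset V, g.IsNClique (U.card + 2 * T.card) Q ∧ ∀ q ∈ Q, ∃ t ∈ U ∪ T, q ∈ X t := by
  induction U using Finset.induction_on with
  | empty =>
    intro X _ h2 h3 h4 h5
    simp only [Finset.empty_union, Finset.card_empty, zero_add] at *
    exact rt_embedT g η hη hη1 p hp T X h2 h3 h4 h5
  | insert a U ha ih =>
    intro X hlow hlowT hedge hbig hcard
    rw [Finset.disjoint_insert_left] at hd
    rw [Finset.insert_union] at hlow hbig ⊢
    have haUT : a ∉ U ∪ T := by simp [ha, hd.1]
    have hcUT : (U ∪ T).card = U.card + T.card := Finset.card_union_of_disjoint hd.2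
    rw [Finset.card_insert_of_notMem ha] at hcard hbig
    have hle : ∀ t ∈ insert a (U ∪ T), 6 * p t ≤ (X t).card := by
      intro t ht
      refine (hbig t ht).trans ?_
      have : η ^ (U.card + 1 + T.card) ≤ 1 := pow_le_one₀ hη.le hη1
      nlinarith [Nat.cast_nonneg (α := ℝ) (X t).card]
    have hne : ∀ t ∈ U ∪ T, a ≠ t := by
      rintro t ht rfl; exact haUT ht
    obtain ⟨X', hX', hpX', hgood⟩ := rt_pick g (X a) (U ∪ T) X (p a) p (fun _ => η) (hp a)
      (fun j hj => hlow a (Finset.mem_insert_self _ _) j (Finset.mem_insert_of_mem hj) (hne j hj))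
      (fun j hj => by
        have := hle j (Finset.mem_insert_of_mem hj)
        have := hp j
        linarith)
      (by
        have h1 := hle a (Finset.mem_insert_self _ _)
        have h2 : ((U ∪ T).card : ℝ) + 1 ≤ 6 := by
          rw [hcUT]; exact_mod_cast (by omega : U.card + T.card + 1 ≤ 6)
        have := hp a
        nlinarith)
    obtain ⟨u, hu⟩ : X'.Nonempty := by
      rw [← Finset.card_pos]
      have : (0 : ℝ) < X'.card := lt_of_lt_of_le (hp a) hpX'
      exact_mod_cast this
    set Z : ι → Finset V := fun t => (X t).filter (g.Adj u) with hZ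
    have hZX : ∀ t, Z t ⊆ X t := fun t => Finset.filter_subset _ _
    have hUT : ∀ t ∈ T, t ∈ U ∪ T := fun t ht => Finset.mem_union_right _ ht
    obtain ⟨Q, hQ, hQX⟩ := ih hd.2 Z
      (fun s hs t ht hst => rtLow_mono (hlow s (Finset.mem_insert_of_mem hs) t
        (Finset.mem_insert_of_mem ht) hst) (hZX s) (hZX t))
      (fun s hs t ht hst => rtLow_mono (hlowT s hs t ht hst) (hZX s) (hZX t))
      (fun t ht A hA => hedge t ht A (hA.trans (hZX t)))
      (fun t ht => by
        refine (hbig t (Finset.mem_insert_of_mem ht)).trans ?_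
        rw [show U.card + 1 + T.card = U.card + T.card + 1 by ring, pow_succ, mul_assoc]
        exact mul_le_mul_of_nonneg_left (hgood u hu t ht) (by positivity))
      (by omega)
    refine ⟨insert u Q, ?_, ?_⟩
    · rw [Finset.card_insert_of_notMem ha]
      have h1 := hQ.insert (a := u) (by
        intro q hq
        obtain ⟨t, _, ht⟩ := hQX q hq
        exact (Finset.mem_filter.1 ht).2)
      rw [show U.card + 1 + 2 * T.card = U.card + 2 * T.card + 1 by ring]
      exact h1
    · intro q hq
      rcases Finset.mem_insert.1 hq with rfl | hq
      · exact ⟨a, Finset.mem_insert_self _ _, hX' hu⟩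
      · obtain ⟨t, ht, ht'⟩ := hQX q hq
        exact ⟨t, Finset.mem_insert_of_mem ht, hZX t ht'⟩

open Classical in
lemma rt_edge_count {n : ℕ} (G : SimpleGraph (Fin n)) :
    2 * (G.edgeSet.ncard : ℝ) = rtE (rtI G) Finset.univ Finset.univ := by
  rw [rtE_rtI]
  have h := G.sum_degrees_eq_twice_card_edges
  have h2 : G.edgeSet.ncard = G.edgeFinset.card := by
    rw [Set.ncard_eq_toFinset_card']; rfl
  rw [h2]
  have h3 : ∑ v, ((Finset.univ.filter (G.Adj v)).card : ℝ) = ((∑ v, G.degree v : ℕ) : ℝ) := by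
    push_cast
    apply Finset.sum_congr rfl
    intro v _
    rw [← SimpleGraph.card_neighborFinset_eq_degree, SimpleGraph.neighborFinset_eq_filter]
  rw [h3, h]
  push_cast
  rfl

lemma rtI_nonneg {V : Type*} (g : SimpleGraph V) (u v : V) : 0 ≤ rtI g u v := by
  unfold rtI; split_ifs <;> norm_num

lemma rtI_le {V : Type*} (g : SimpleGraph V) (u v : V) : rtI g u v ≤ 1 := by
  unfold rtI; split_ifs <;> norm_num

lemma rtE_le {V : Type*} (g : SimpleGraph V) (A B : Finset V) :
    rtE (rtI g) A B ≤ A.card * B.card := by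
  calc rtE (rtI g) A B ≤ ∑ u ∈ A, ∑ v ∈ B, (1 : ℝ) :=
        Finset.sum_le_sum fun u _ => Finset.sum_le_sum fun v _ => rtI_le g u v
    _ = _ := by simp

lemma rtE_symm {V : Type*} (g : SimpleGraph V) (A B : Finset V) :
    rtE (rtI g) A B = rtE (rtI g) B A := by
  unfold rtE
  rw [Finset.sum_comm]
  apply Finset.sum_congr rfl; intro u _
  apply Finset.sum_congr rfl; intro v _
  unfold rtI
  by_cases h : g.Adj u v
  · simp [h, h.symm]
  · have h' : ¬ g.Adj v u := fun h' => h h'.symm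
    simp [h, h']

lemma rtD_symm {V κ : Type*} [Fintype V] (g : SimpleGraph V) (c : V → κ) (i j : κ) :
    rtD (rtI g) c i j = rtD (rtI g) c j i := by
  rw [rtD, rtD, rtE_symm, mul_comm]

lemma rtE_sup {V : Type*} (E₁ E₂ : SimpleGraph V) (h : E₁ ⊓ E₂ = ⊥) (A B : Finset V) :
    rtE (rtI (E₁ ⊔ E₂)) A B = rtE (rtI E₁) A B + rtE (rtI E₂) A B := by
  unfold rtE
  rw [← Finset.sum_add_distrib]
  apply Finset.sum_congr rfl; intro u _
  rw [← Finset.sum_add_distrib]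
  apply Finset.sum_congr rfl; intro v _
  have h' : ¬ (E₁.Adj u v ∧ E₂.Adj u v) := by
    rw [← SimpleGraph.inf_adj, h]; simp
  simp only [rtI, SimpleGraph.sup_adj]
  by_cases h1 : E₁.Adj u v <;> by_cases h2 : E₂.Adj u v <;> simp_all

lemma rtE_eq_rtD {V κ : Type*} [Fintype V] (g : SimpleGraph V) (c : V → κ) (i j : κ) :
    rtE (rtI g) (rtCls c i) (rtCls c j) =
      rtD (rtI g) c i j * ((rtCls c i).card * (rtCls c j).card) := by
  rw [rtD]
  rcases eq_or_ne ((rtCls c i).card * (rtCls c j).card : ℝ) 0 with h | h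
  · rw [h, mul_zero]
    apply le_antisymm
    · exact (rtE_le g _ _).trans h.le
    · exact Finset.sum_nonneg fun u _ => Finset.sum_nonneg fun v _ => rtI_nonneg g u v
  · rw [div_mul_cancel₀ _ h]

lemma rt_low_of_reg {V κ : Type*} [Fintype V] (g : SimpleGraph V) (c : V → κ) (ε d : ℝ) (i j : κ)
    (h : ¬ rtIrr (rtI g) c ε i j) (hd : d + ε ≤ rtD (rtI g) c i j) (X Y : Finset V)
    (hX : X ⊆ rtCls c i) (hY : Y ⊆ rtCls c j) :
    rtLow g X Y (ε * (rtCls c i).card) (ε * (rtCls c j).card) d := by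
  intro A B hA hB hp hq
  by_contra hcon
  push Not at hcon
  apply h
  refine ⟨A, B, hA.trans hX, hB.trans hY, hp, hq, lt_of_lt_of_le hcon ?_⟩
  apply mul_le_mul_of_nonneg_right _ (by positivity)
  linarith

open Classical in
lemma rt_typeB {V κ : Type*} [Fintype V] (g : SimpleGraph V) (hg : g.CliqueFree 3) (c : V → κ)
    (η : ℝ) (hη : 0 < η) (i j : κ) (h : 2 * η ≤ rtD (rtI g) c i j)
    (hi : 0 < (rtCls c i).card) (hj : 0 < (rtCls c j).card) :
    ∃ A ⊆ rtCls c j, η * (rtCls c j).card ≤ A.card ∧ ∀ u ∈ A, ∀ v ∈ A, ¬ g.Adj u v := by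
  have h1 := rtE_eq_rtD g c i j
  rw [rtE_rtI] at h1
  have hi' : (0 : ℝ) < (rtCls c i).card := by exact_mod_cast hi
  have hj' : (0 : ℝ) < (rtCls c j).card := by exact_mod_cast hj
  obtain ⟨u, hu, hdeg⟩ : ∃ u ∈ rtCls c i, η * (rtCls c j).card ≤
      (((rtCls c j).filter (g.Adj u)).card : ℝ) := by
    by_contra hcon
    push Not at hcon
    have h2 : ∑ u ∈ rtCls c i, (((rtCls c j).filter (g.Adj u)).card : ℝ) ≤
        ∑ u ∈ rtCls c i, η * (rtCls c j).card := Finset.sum_le_sum fun u hu => (hcon u hu).le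
    rw [Finset.sum_const, nsmul_eq_mul, h1] at h2
    have h3 : 0 < ((rtCls c i).card * (rtCls c j).card : ℝ) := by positivity
    have h4 := mul_le_mul_of_nonneg_right h h3.le
    have h5 : 0 < η * ((rtCls c i).card * (rtCls c j).card : ℝ) := by positivity
    linarith
  refine ⟨_, Finset.filter_subset _ _, hdeg, ?_⟩
  intro v hv w hw hvw
  have hv := (Finset.mem_filter.1 hv).2
  have hw := (Finset.mem_filter.1 hw).2
  exact hg {u, v, w} (SimpleGraph.is3Clique_triple_iff.2 ⟨hv, hw, hvw⟩)

lemma rt_sum_cls {V κ : Type*} [Fintype V] [Fintype κ] (c : V → κ) (φ : V → ℝ) :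
    ∑ v, φ v = ∑ i, ∑ v ∈ rtCls c i, φ v := by
  classical
  rw [← Finset.sum_fiberwise Finset.univ c φ]
  apply Finset.sum_congr rfl
  intro i _
  apply Finset.sum_congr _ (fun _ _ => rfl)
  ext v; simp [rtCls_mem]

lemma rtE_univ {V κ : Type*} [Fintype V] [Fintype κ] (c : V → κ) (g : V → V → ℝ) :
    rtE g Finset.univ Finset.univ = ∑ i, ∑ j, rtE g (rtCls c i) (rtCls c j) := by
  unfold rtE
  rw [rt_sum_cls c]
  apply Finset.sum_congr rfl
  intro i _
  rw [Finset.sum_comm]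
  rw [Finset.sum_comm]
  simp_rw [rt_sum_cls c (fun v => g _ v)]
  rw [Finset.sum_comm]

lemma rt_card_cls {V κ : Type*} [Fintype V] [Fintype κ] (c : V → κ) :
    ∑ i, ((rtCls c i).card : ℝ) = Fintype.card V := by
  have := rt_sum_cls c (fun _ => (1 : ℝ))
  simpa using this.symm

open Classical in
lemma rtMass_eq {V κ : Type*} [Fintype V] [Fintype κ] (g : V → V → ℝ) (c : V → κ) (ε : ℝ) :
    rtMass g c ε = ∑ i, ∑ j, if rtIrr g c ε i j then
      ((rtCls c i).card * (rtCls c j).card : ℝ) else 0 := by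
  rw [rtMass, Finset.sum_filter, Fintype.sum_prod_type]

lemma rt_pointwise (D₁ D₂ w y η : ℝ) (hy : 0 ≤ y)
    (h12 : (D₁ + D₂) * y ≤ y) (hη : 0 < η)
    (hw : (w = 1) ∨ (w = 1 / 2 ∧ D₁ < 2 * η ∧ D₂ < 1 / 2 + 2 * η) ∨
      (w = 0 ∧ D₁ < 2 * η ∧ D₂ < 2 * η)) :
    (D₁ + D₂) * y ≤ w * y + 4 * η * y := by
  have hηy : 0 ≤ 4 * η * y := by positivity
  rcases hw with h | ⟨h, h1, h2⟩ | ⟨h, h1, h2⟩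
  · rw [h]; linarith
  · rw [h, ← add_mul]; apply mul_le_mul_of_nonneg_right _ hy; linarith
  · rw [h, ← add_mul]; apply mul_le_mul_of_nonneg_right _ hy; linarith

open Classical in
lemma rt_count {V κ : Type} [Fintype V] [Fintype κ] (E₁ E₂ : SimpleGraph V)
    (hdis : E₁ ⊓ E₂ = ⊥) (η ε₁ n : ℝ) (K : ℕ) (c : V → κ) (hη : 0 < η)
    (hε₁le : ε₁ ≤ η) (hK' : (0 : ℝ) < K) (hcard : Fintype.card κ ≤ K) (hn' : 0 < n)
    (x : κ → ℝ) (hx : x = fun i => ((rtCls c i).card : ℝ)) (hx0 : ∀ i, 0 ≤ x i)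
    (hxsum : ∑ i, x i = n)
    (U : Finset κ) (hUc : ∀ i, i ∉ U → x i ≤ η * n / K)
    (isR : κ → Prop) (r b f : κ → κ → Prop)
    (hrdef : ∀ i j, ¬ rtIrr (rtI E₁) c ε₁ i j → ¬ rtIrr (rtI E₁) c ε₁ j i →
      ¬ rtIrr (rtI E₂) c ε₁ i j → ¬ rtIrr (rtI E₂) c ε₁ j i →
      (2 * η ≤ rtD (rtI E₁) c i j → r i j) ∧ (2 * η ≤ rtD (rtI E₂) c i j → b i j) ∧
      (1 / 2 + 2 * η ≤ rtD (rtI E₂) c i j → f i j))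
    (hW : ∑ i ∈ U, ∑ j ∈ U, rtW isR r b f i j * (x i * x j) ≤ 5 / 6 * (∑ i ∈ U, x i) ^ 2)
    (hsmall : ∀ i, x i ≤ 2 * η * n)
    (hm1 : rtMass (rtI E₁) c ε₁ ≤ ε₁ * n ^ 2)
    (hm2 : rtMass (rtI E₂) c ε₁ ≤ ε₁ * n ^ 2) :
    rtE (rtI (E₁ ⊔ E₂)) Finset.univ Finset.univ ≤ (5 / 6 + 12 * η) * n ^ 2 := by
  have hxy : ∀ i j, 0 ≤ x i * x j := fun i j => mul_nonneg (hx0 i) (hx0 j)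
  have hpt : ∀ i j, rtE (rtI (E₁ ⊔ E₂)) (rtCls c i) (rtCls c j) ≤
      (if i ∈ U ∧ j ∈ U then rtW isR r b f i j * (x i * x j) else 0) + 4 * η * (x i * x j) +
      (if i = j then x i * x j else 0) + (if i ∈ U then 0 else x i * x j) +
      (if j ∈ U then 0 else x i * x j) +
      (if rtIrr (rtI E₁) c ε₁ i j then x i * x j else 0) +
      (if rtIrr (rtI E₁) c ε₁ j i then x i * x j else 0) +
      (if rtIrr (rtI E₂) c ε₁ i j then x i * x j else 0) +
      (if rtIrr (rtI E₂) c ε₁ j i then x i * x j else 0) := by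
    intro i j
    have hle : rtE (rtI (E₁ ⊔ E₂)) (rtCls c i) (rtCls c j) ≤ x i * x j := by
      rw [hx]; exact rtE_le _ _ _
    have hy := hxy i j
    have hηy : 0 ≤ 4 * η * (x i * x j) := by positivity
    have q0 : 0 ≤ (if i ∈ U ∧ j ∈ U then rtW isR r b f i j * (x i * x j) else 0) := by
      split_ifs
      · apply mul_nonneg _ hy
        unfold rtW; split_ifs <;> norm_num
      · exact le_rfl
    have q1 : 0 ≤ (if i = j then x i * x j else 0) := by split_ifs <;> simp [hy]
    have q2 : 0 ≤ (if i ∈ U then 0 else x i * x j) := by split_ifs <;> simp [hy]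
    have q3 : 0 ≤ (if j ∈ U then 0 else x i * x j) := by split_ifs <;> simp [hy]
    have q4 : ∀ P : Prop, 0 ≤ (if P then x i * x j else 0) := by
      intro P; split_ifs <;> simp [hy]
    have q5 := q4 (rtIrr (rtI E₁) c ε₁ i j)
    have q6 := q4 (rtIrr (rtI E₁) c ε₁ j i)
    have q7 := q4 (rtIrr (rtI E₂) c ε₁ i j)
    have q8 := q4 (rtIrr (rtI E₂) c ε₁ j i)
    by_cases c1 : i = j
    · rw [if_pos c1] at q1 ⊢; linarith
    by_cases c2 : i ∈ U
    swap
    · rw [if_neg c2] at q2; rw [if_neg c2]; linarith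
    by_cases c3 : j ∈ U
    swap
    · rw [if_neg c3] at q3; rw [if_neg c3]; linarith
    by_cases c4 : rtIrr (rtI E₁) c ε₁ i j
    · rw [if_pos c4] at q5 ⊢; linarith
    by_cases c5 : rtIrr (rtI E₁) c ε₁ j i
    · rw [if_pos c5] at q6 ⊢; linarith
    by_cases c6 : rtIrr (rtI E₂) c ε₁ i j
    · rw [if_pos c6] at q7 ⊢; linarith
    by_cases c7 : rtIrr (rtI E₂) c ε₁ j i
    · rw [if_pos c7] at q8 ⊢; linarith
    obtain ⟨hr, hb, hf⟩ := hrdef i j c4 c5 c6 c7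
    rw [if_pos ⟨c2, c3⟩]
    have hmain : rtE (rtI (E₁ ⊔ E₂)) (rtCls c i) (rtCls c j) ≤
        rtW isR r b f i j * (x i * x j) + 4 * η * (x i * x j) := by
      have he : rtE (rtI (E₁ ⊔ E₂)) (rtCls c i) (rtCls c j) =
          (rtD (rtI E₁) c i j + rtD (rtI E₂) c i j) * (x i * x j) := by
        rw [rtE_sup _ _ hdis, rtE_eq_rtD, rtE_eq_rtD, add_mul, hx]
      rw [he] at hle ⊢
      apply rt_pointwise _ _ _ _ _ hy hle hη
      unfold rtW
      rw [if_neg c1]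
      split_ifs with k1 k2
      · exact Or.inl rfl
      · right; left
        push Not at k1
        refine ⟨rfl, ?_, ?_⟩
        · by_contra hc; push Not at hc
          exact k1.1 (hr hc)
        · by_contra hc; push Not at hc
          exact (k1.2 k2).2.2 (hf hc)
      · right; right
        push Not at k1
        refine ⟨rfl, ?_, ?_⟩
        · by_contra hc; push Not at hc
          exact k1.1 (hr hc)
        · by_contra hc; push Not at hc
          exact k2 (hb hc)
    linarith
  have hxx : ∑ i, ∑ j, x i * x j = n ^ 2 := by
    rw [← Finset.sum_mul_sum, hxsum, sq]
  have t0 : ∑ i, ∑ j, (if i ∈ U ∧ j ∈ U then rtW isR r b f i j * (x i * x j) else 0) ≤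
      5 / 6 * n ^ 2 := by
    have e1 : ∑ i, ∑ j, (if i ∈ U ∧ j ∈ U then rtW isR r b f i j * (x i * x j) else 0) =
        ∑ i ∈ U, ∑ j ∈ U, rtW isR r b f i j * (x i * x j) := by
      rw [← Finset.sum_filter_add_sum_filter_not Finset.univ (· ∈ U)]
      rw [Finset.filter_univ_mem]
      have z : ∑ i with i ∉ U, ∑ j, (if i ∈ U ∧ j ∈ U then rtW isR r b f i j * (x i * x j) else 0)
          = 0 := by
        apply Finset.sum_eq_zero
        intro i hi
        apply Finset.sum_eq_zero
        intro j _
        rw [if_neg]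
        exact fun h => (Finset.mem_filter.1 hi).2 h.1
      rw [z, add_zero]
      apply Finset.sum_congr rfl
      intro i hi
      simp only [hi, true_and]
      rw [← Finset.sum_filter, Finset.filter_univ_mem]
    rw [e1]
    refine hW.trans ?_
    have hle : ∑ i ∈ U, x i ≤ n := by
      rw [← hxsum]
      exact Finset.sum_le_sum_of_subset_of_nonneg (Finset.subset_univ _) fun i _ _ => hx0 i
    have h0 : 0 ≤ ∑ i ∈ U, x i := Finset.sum_nonneg fun i _ => hx0 i
    have := pow_le_pow_left₀ h0 hle 2
    linarith
  have t1 : ∑ i, ∑ j, (if i = j then x i * x j else 0) ≤ 2 * η * n ^ 2 := by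
    simp only [Finset.sum_ite_eq, Finset.mem_univ, if_true]
    calc ∑ i, x i * x i ≤ ∑ i, (2 * η * n) * x i :=
          Finset.sum_le_sum fun i _ => mul_le_mul_of_nonneg_right (hsmall i) (hx0 i)
      _ = 2 * η * n ^ 2 := by rw [← Finset.mul_sum, hxsum]; ring
  have hsm : ∑ i, (if i ∈ U then 0 else x i) ≤ η * n := by
    calc ∑ i, (if i ∈ U then 0 else x i) ≤ ∑ i : κ, η * n / K := by
          apply Finset.sum_le_sum
          intro i _
          split_ifs with h
          · positivity
          · exact hUc i h
      _ = Fintype.card κ * (η * n / K) := by simp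
      _ ≤ K * (η * n / K) := by
          apply mul_le_mul_of_nonneg_right _ (by positivity)
          exact_mod_cast hcard
      _ = η * n := by field_simp
  have t2 : ∑ i, ∑ j, (if i ∈ U then 0 else x i * x j) ≤ η * n ^ 2 := by
    have e : ∑ i, ∑ j, (if i ∈ U then 0 else x i * x j) =
        (∑ i, (if i ∈ U then 0 else x i)) * ∑ j, x j := by
      rw [Finset.sum_mul_sum]
      apply Finset.sum_congr rfl; intro i _
      apply Finset.sum_congr rfl; intro j _
      split_ifs <;> simp
    rw [e, hxsum]
    nlinarith
  have t3 : ∑ i, ∑ j, (if j ∈ U then 0 else x i * x j) ≤ η * n ^ 2 := by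
    rw [Finset.sum_comm]
    simpa only [mul_comm] using t2
  have tm : ∀ g : SimpleGraph V, rtMass (rtI g) c ε₁ ≤ ε₁ * n ^ 2 →
      ∑ i, ∑ j, (if rtIrr (rtI g) c ε₁ i j then x i * x j else 0) ≤ η * n ^ 2 ∧
      ∑ i, ∑ j, (if rtIrr (rtI g) c ε₁ j i then x i * x j else 0) ≤ η * n ^ 2 := by
    intro g hg
    have h1 : ε₁ * n ^ 2 ≤ η * n ^ 2 := mul_le_mul_of_nonneg_right hε₁le (by positivity)
    have h2 : ∑ i, ∑ j, (if rtIrr (rtI g) c ε₁ i j then x i * x j else 0) ≤ η * n ^ 2 := by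
      rw [rtMass_eq] at hg
      rw [hx]
      exact hg.trans h1
    refine ⟨h2, ?_⟩
    rw [Finset.sum_comm]
    refine le_trans (le_of_eq ?_) h2
    apply Finset.sum_congr rfl; intro i _
    apply Finset.sum_congr rfl; intro j _
    rw [mul_comm]
  obtain ⟨t4, t5⟩ := tm E₁ hm1
  obtain ⟨t6, t7⟩ := tm E₂ hm2
  have t8 : ∑ i, ∑ j, 4 * η * (x i * x j) = 4 * η * n ^ 2 := by
    simp only [← Finset.mul_sum]
    rw [← hxx]
    simp only [Finset.mul_sum]
  rw [rtE_univ c]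
  have hfin := Finset.sum_le_sum (s := Finset.univ) fun i _ =>
    Finset.sum_le_sum (s := Finset.univ) fun j _ => hpt i j
  simp only [Finset.sum_add_distrib] at hfin
  linarith

lemma rt_pow_aux (η ε₁ : ℝ) (hη : 0 < η) (hη1 : η ≤ 1) (hε₁η : 6 * ε₁ ≤ η ^ 7) :
    ∀ k : ℕ, k ≤ 6 → ∀ y z : ℝ, 0 ≤ y → η * y ≤ z → 6 * (ε₁ * y) ≤ η ^ k * z := by
  intro k hk y z hy hz
  calc 6 * (ε₁ * y) = (6 * ε₁) * y := by ring
    _ ≤ η ^ 7 * y := mul_le_mul_of_nonneg_right hε₁η hy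
    _ = η ^ 6 * (η * y) := by ring
    _ ≤ η ^ k * (η * y) := mul_le_mul_of_nonneg_right (pow_le_pow_of_le_one hη.le hη1 hk)
        (by positivity)
    _ ≤ η ^ k * z := mul_le_mul_of_nonneg_left hz (by positivity)

open Classical in
lemma rt_red {V κ : Type} [Fintype V] (E₁ : SimpleGraph V) (h3 : E₁.CliqueFree 3)
    (η ε₁ : ℝ) (c : V → κ) (hη : 0 < η) (hη1 : η ≤ 1) (hε₁le : ε₁ ≤ η) (hε₁η : 6 * ε₁ ≤ η ^ 7)
    (p : κ → ℝ) (hp0 : ∀ t, 0 < p t) (U : Finset κ) (hpU : ∀ t ∈ U, p t = ε₁ * (rtCls c t).card)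
    (i j k : κ) (hi : i ∈ U) (hj : j ∈ U) (hk : k ∈ U) (hij : i ≠ j) (hik : i ≠ k) (hjk : j ≠ k)
    (rij : ¬ rtIrr (rtI E₁) c ε₁ i j ∧ ¬ rtIrr (rtI E₁) c ε₁ j i ∧ 2 * η ≤ rtD (rtI E₁) c i j)
    (rik : ¬ rtIrr (rtI E₁) c ε₁ i k ∧ ¬ rtIrr (rtI E₁) c ε₁ k i ∧ 2 * η ≤ rtD (rtI E₁) c i k)
    (rjk : ¬ rtIrr (rtI E₁) c ε₁ j k ∧ ¬ rtIrr (rtI E₁) c ε₁ k j ∧ 2 * η ≤ rtD (rtI E₁) c j k) :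
    False := by
  have hpow := rt_pow_aux η ε₁ hη hη1 hε₁η
  obtain ⟨r, hr⟩ : ∃ r : κ → κ → Prop, ∀ s t, r s t ↔ (¬ rtIrr (rtI E₁) c ε₁ s t ∧
      ¬ rtIrr (rtI E₁) c ε₁ t s ∧ 2 * η ≤ rtD (rtI E₁) c s t) := ⟨_, fun _ _ => Iff.rfl⟩
  rw [← hr] at rij rik rjk
  have hc : ({i, j, k} : Finset κ).card = 3 := Finset.card_eq_three.2 ⟨i, j, k, hij, hik, hjk, rfl⟩
  have hsub : ∀ t ∈ ({i, j, k} : Finset κ), t ∈ U := by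
    intro t ht
    simp only [Finset.mem_insert, Finset.mem_singleton] at ht
    rcases ht with rfl | rfl | rfl <;> assumption
  have hrs : ∀ s t, r s t → r t s := fun s t h => by
    rw [hr] at h ⊢
    exact ⟨h.2.1, h.1, by rw [rtD_symm]; exact h.2.2⟩
  have hall : ∀ s ∈ ({i, j, k} : Finset κ), ∀ t ∈ ({i, j, k} : Finset κ), s ≠ t → r s t := by
    intro s hs t ht hst
    simp only [Finset.mem_insert, Finset.mem_singleton] at hs ht
    rcases hs with rfl | rfl | rfl <;> rcases ht with rfl | rfl | rfl <;>
      first | exact absurd rfl hst | assumption | (apply hrs; assumption)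
  obtain ⟨Q, hQ, -⟩ := rt_embedS E₁ η hη hη1 p hp0 ∅ {i, j, k} (Finset.disjoint_empty_right _) (rtCls c)
    (by
      intro s hs t ht hst
      rw [Finset.union_empty] at hs ht
      rw [hpU s (hsub s hs), hpU t (hsub t ht)]
      have := (hr s t).1 (hall s hs t ht hst)
      exact rt_low_of_reg E₁ c ε₁ η s t this.1 (by have := this.2.2; linarith) _ _
        subset_rfl subset_rfl)
    (fun s hs => absurd hs (Finset.notMem_empty s))
    (fun s hs => absurd hs (Finset.notMem_empty s))
    (by
      intro t ht
      rw [Finset.union_empty] at ht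
      rw [hpU t (hsub t ht), hc, Finset.card_empty]
      refine hpow 3 (by norm_num) _ _ (by positivity) ?_
      have : (0 : ℝ) ≤ (rtCls c t).card := by positivity
      nlinarith)
    (by rw [hc, Finset.card_empty]; norm_num)
  rw [hc, Finset.card_empty] at hQ
  exact h3 Q hQ

open Classical in
lemma rt_blue {V κ : Type} [Fintype V] (E₁ E₂ : SimpleGraph V) (h6 : E₂.CliqueFree 6)
    (η ε₁ α : ℝ) (c : V → κ) (hη : 0 < η) (hη1 : η ≤ 1) (hε₁ : 0 < ε₁) (hε₁le : ε₁ ≤ η)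
    (hε₁η : 6 * ε₁ ≤ η ^ 7) (p : κ → ℝ) (hp0 : ∀ t, 0 < p t) (U : Finset κ)
    (hpU : ∀ t ∈ U, p t = ε₁ * (rtCls c t).card)
    (hbig : ∀ t ∈ U, α < ε₁ * (rtCls c t).card)
    (hind : ∀ s : Finset V, (∀ x ∈ s, ∀ y ∈ s, x ≠ y → ¬ (E₁ ⊔ E₂).Adj x y) → (s.card : ℝ) ≤ α)
    (S T : Finset κ) (hTS : T ⊆ S) (hSU : S ⊆ U)
    (hSb : ∀ s ∈ S, ∀ t ∈ S, s ≠ t → ¬ rtIrr (rtI E₂) c ε₁ s t ∧ 2 * η ≤ rtD (rtI E₂) c s t)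
    (hTf : ∀ s ∈ T, ∀ t ∈ T, s ≠ t →
      ¬ rtIrr (rtI E₂) c ε₁ s t ∧ 1 / 2 + 2 * η ≤ rtD (rtI E₂) c s t)
    (hTR : ∀ t ∈ T, ∃ A ⊆ rtCls c t, η * (rtCls c t).card ≤ A.card ∧
      ∀ u ∈ A, ∀ v ∈ A, ¬ E₁.Adj u v)
    (hcardST : S.card + T.card = 6) : False := by
  have hpow := rt_pow_aux η ε₁ hη hη1 hε₁η
  set X : κ → Finset V := fun t => if h : ∃ A ⊆ rtCls c t, η * (rtCls c t).card ≤ A.card ∧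
    ∀ u ∈ A, ∀ v ∈ A, ¬ E₁.Adj u v then h.choose else rtCls c t with hX
  have hXsub : ∀ t, X t ⊆ rtCls c t := by
    intro t
    simp only [hX]
    split_ifs with h
    · exact h.choose_spec.1
    · exact subset_rfl
  have hXcard : ∀ t, η * (rtCls c t).card ≤ (X t).card := by
    intro t
    simp only [hX]
    split_ifs with h
    · exact h.choose_spec.2.1
    · have : (0 : ℝ) ≤ (rtCls c t).card := by positivity
      nlinarith
  have hXT : ∀ t ∈ T, ∀ u ∈ X t, ∀ v ∈ X t, ¬ E₁.Adj u v := by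
    intro t ht
    have h := hTR t ht
    simp only [hX]
    rw [dif_pos h]
    exact h.choose_spec.2.2
  have hun : (S \ T) ∪ T = S := Finset.sdiff_union_of_subset hTS
  have hc : (S \ T).card + T.card = S.card := Finset.card_sdiff_add_card_eq_card hTS
  have hTU : ∀ t ∈ T, t ∈ U := fun t ht => hSU (hTS ht)
  obtain ⟨Q, hQ, -⟩ := rt_embedS E₂ η hη hη1 p hp0 T (S \ T) Finset.sdiff_disjoint X
    (by
      intro s hs t ht hst
      rw [hun] at hs ht
      rw [hpU s (hSU hs), hpU t (hSU ht)]
      have := hSb s hs t ht hst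
      exact rt_low_of_reg E₂ c ε₁ η s t this.1 (by have := this.2; linarith) _ _
        (hXsub s) (hXsub t))
    (by
      intro s hs t ht hst
      rw [hpU s (hTU s hs), hpU t (hTU t ht)]
      have := hTf s hs t ht hst
      exact rt_low_of_reg E₂ c ε₁ (1 / 2 + η) s t this.1
        (by have := this.2; linarith) _ _ (hXsub s) (hXsub t))
    (by
      intro t ht A hA hpA
      by_contra hcon
      push Not at hcon
      have h1 := hind A (by
        intro u hu v hv _ huv
        rw [SimpleGraph.sup_adj] at huv
        rcases huv with huv | huv
        · exact hXT t ht u (hA hu) v (hA hv) huv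
        · exact hcon u hu v hv huv)
      rw [hpU t (hTU t ht)] at hpA
      have h2 := hbig t (hTU t ht)
      linarith)
    (by
      intro t ht
      rw [hun] at ht
      rw [hpU t (hSU ht), hc]
      exact hpow _ (by omega) _ _ (by positivity) (hXcard t))
    (by omega)
  rw [show (S \ T).card + 2 * T.card = 6 by omega] at hQ
  exact h6 Q hQ

set_option maxHeartbeats 1000000 in
open Classical in
lemma rt_core {V κ : Type} [Fintype V] [Fintype κ] (E₁ E₂ : SimpleGraph V)
    (hdis : E₁ ⊓ E₂ = ⊥) (h3 : E₁.CliqueFree 3) (h6 : E₂.CliqueFree 6)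
    (η ε₁ δ : ℝ) (K : ℕ) (c : V → κ) (hη : 0 < η) (hη1 : η ≤ 1) (hε₁ : 0 < ε₁)
    (hε₁η : 6 * ε₁ ≤ η ^ 7) (hK : 0 < K) (hcard : Fintype.card κ ≤ K)
    (hn : 0 < Fintype.card V)
    (hδ : δ * Fintype.card V < ε₁ * (η * Fintype.card V / K))
    (hind : ∀ s : Finset V, (∀ x ∈ s, ∀ y ∈ s, x ≠ y → ¬ (E₁ ⊔ E₂).Adj x y) →
      (s.card : ℝ) ≤ δ * Fintype.card V)
    (hsmall : ∀ i, ((rtCls c i).card : ℝ) ≤ 2 * η * Fintype.card V)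
    (hm1 : rtMass (rtI E₁) c ε₁ ≤ ε₁ * (Fintype.card V : ℝ) ^ 2)
    (hm2 : rtMass (rtI E₂) c ε₁ ≤ ε₁ * (Fintype.card V : ℝ) ^ 2) :
    rtE (rtI (E₁ ⊔ E₂)) Finset.univ Finset.univ ≤ (5 / 6 + 12 * η) * (Fintype.card V : ℝ) ^ 2 := by
  set n : ℝ := (Fintype.card V : ℝ) with hndef
  have hn' : 0 < n := by rw [hndef]; exact_mod_cast hn
  have hK' : (0 : ℝ) < K := by exact_mod_cast hK
  set x : κ → ℝ := fun i => ((rtCls c i).card : ℝ) with hx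
  have hx0 : ∀ i, 0 ≤ x i := fun i => Nat.cast_nonneg _
  have hxsum : ∑ i, x i = n := rt_card_cls c
  have hε₁le : ε₁ ≤ η := by
    have : η ^ 7 ≤ η := by
      calc η ^ 7 = η ^ 6 * η := by ring
        _ ≤ 1 * η := mul_le_mul_of_nonneg_right (pow_le_one₀ hη.le hη1) hη.le
        _ = η := one_mul _
    linarith
  set big : κ → Prop := fun i => η * n / K ≤ x i with hbig
  have hbigpos : ∀ i, big i → 0 < x i := fun i hi => lt_of_lt_of_le (by positivity) hi
  set U : Finset κ := Finset.univ.filter big with hU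
  set p : κ → ℝ := fun i => if big i then ε₁ * x i else 1 with hp
  have hp0 : ∀ t, 0 < p t := by
    intro t
    simp only [hp]
    split_ifs with h
    · exact mul_pos hε₁ (hbigpos t h)
    · norm_num
  have hpU : ∀ t ∈ U, p t = ε₁ * (rtCls c t).card := by
    intro t ht
    simp only [hp, if_pos (Finset.mem_filter.1 ht).2, hx]
  set isR : κ → Prop := fun i => ¬ ∃ A ⊆ rtCls c i, η * (rtCls c i).card ≤ A.card ∧
    ∀ u ∈ A, ∀ v ∈ A, ¬ E₁.Adj u v with hisR
  set reg : κ → κ → Prop := fun i j => ¬ rtIrr (rtI E₁) c ε₁ i j ∧ ¬ rtIrr (rtI E₁) c ε₁ j i ∧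
    ¬ rtIrr (rtI E₂) c ε₁ i j ∧ ¬ rtIrr (rtI E₂) c ε₁ j i with hreg
  have hregs : ∀ i j, reg i j → reg j i := fun i j h => ⟨h.2.1, h.1, h.2.2.2, h.2.2.1⟩
  set r : κ → κ → Prop := fun i j => reg i j ∧ 2 * η ≤ rtD (rtI E₁) c i j with hr
  set b : κ → κ → Prop := fun i j => reg i j ∧ 2 * η ≤ rtD (rtI E₂) c i j with hb
  set f : κ → κ → Prop := fun i j => reg i j ∧ 1 / 2 + 2 * η ≤ rtD (rtI E₂) c i j with hf
  have hpos : ∀ i ∈ U, 0 < (rtCls c i).card := by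
    intro i hi
    have := hbigpos i (Finset.mem_filter.1 hi).2
    simp only [hx] at this
    exact_mod_cast this
  have hW := rt_weighted U x isR r b f (fun i _ => hx0 i)
    (fun i j h => ⟨hregs i j h.1, by rw [rtD_symm]; exact h.2⟩)
    (fun i j h => ⟨hregs i j h.1, by rw [rtD_symm]; exact h.2⟩)
    (fun i j h => ⟨hregs i j h.1, by rw [rtD_symm]; exact h.2⟩)
    (fun i j h => ⟨h.1, by have := h.2; linarith⟩)
    (by
      intro i hi j hj hij
      refine ⟨not_not.2 ?_, not_not.2 ?_⟩
      exacts [rt_typeB E₁ h3 c η hη j i (by rw [rtD_symm]; exact hij.2) (hpos j hj) (hpos i hi),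
        rt_typeB E₁ h3 c η hη i j hij.2 (hpos i hi) (hpos j hj)])
    (by
      intro i hi j hj k hk hij hik hjk rij rik rjk
      exact rt_red E₁ h3 η ε₁ c hη hη1 hε₁le hε₁η p hp0 U hpU i j k hi hj hk hij hik hjk
        ⟨rij.1.1, rij.1.2.1, rij.2⟩ ⟨rik.1.1, rik.1.2.1, rik.2⟩ ⟨rjk.1.1, rjk.1.2.1, rjk.2⟩)
    (by
      intro S T hTS hSU hSb hTf hTR hcardST
      exact rt_blue E₁ E₂ h6 η ε₁ (δ * n) c hη hη1 hε₁ hε₁le hε₁η p hp0 U hpU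
        (fun t ht => lt_of_lt_of_le hδ
          (mul_le_mul_of_nonneg_left (Finset.mem_filter.1 ht).2 hε₁.le)) hind S T hTS hSU
        (fun s hs t ht hst => ⟨(hSb hs ht hst).1.2.2.1, (hSb hs ht hst).2⟩)
        (fun s hs t ht hst => ⟨(hTf hs ht hst).1.2.2.1, (hTf hs ht hst).2⟩)
        (fun t ht => not_not.1 (hTR t ht)) hcardST)
  exact rt_count E₁ E₂ hdis η ε₁ n K c hη hε₁le hK' hcard hn' x hx hx0 hxsum U
    (fun i hi => by
      by_contra hc
      exact hi (Finset.mem_filter.2 ⟨Finset.mem_univ _, (not_le.1 hc).le⟩))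
    isR r b f
    (fun i j c4 c5 c6 c7 => ⟨fun h => ⟨⟨c4, c5, c6, c7⟩, h⟩, fun h => ⟨⟨c4, c5, c6, c7⟩, h⟩,
      fun h => ⟨⟨c4, c5, c6, c7⟩, h⟩⟩)
    hW hsmall hm1 hm2

lemma rt_mod_class (n m : ℕ) (hm : 0 < m) (i : Fin m) :
    (rtCls (fun v : Fin n => (⟨v.val % m, Nat.mod_lt _ hm⟩ : Fin m)) i).card ≤ n / m + 1 := by
  rw [← Finset.card_range (n / m + 1)]
  apply Finset.card_le_card_of_injOn (fun v => v.val / m)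
  · intro v hv
    simp only [Finset.coe_range, Set.mem_Iio]
    have : v.val / m ≤ n / m := Nat.div_le_div_right v.isLt.le
    omega
  · intro u hu v hv huv
    have hu' := (rtCls_mem _ _ _).1 (Finset.mem_coe.1 hu)
    have hv' := (rtCls_mem _ _ _).1 (Finset.mem_coe.1 hv)
    have h1 : u.val % m = v.val % m := congrArg Fin.val (hu'.trans hv'.symm)
    have h2 : u.val / m = v.val / m := huv
    apply Fin.ext
    rw [← Nat.div_add_mod u.val m, ← Nat.div_add_mod v.val m, h1, h2]

/-- Upper bound half of ρ(3,6) = 5/12: for every ε > 0 there are δ > 0 and N such that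
every n-vertex graph (n ≥ N) with independence number at most δn whose edges can be
2-colored with no red K₃ and no blue K₆ has at most (5/12 + ε)n² edges. -/
theorem rt_3_6_upper :
    ∀ ε : ℝ, 0 < ε → ∃ δ : ℝ, 0 < δ ∧ ∃ N : ℕ, 0 < N ∧
      ∀ n : ℕ, N ≤ n → ∀ G : SimpleGraph (Fin n),
        (∀ s : Finset (Fin n),
            (∀ x ∈ s, ∀ y ∈ s, x ≠ y → ¬ G.Adj x y) → (s.card : ℝ) ≤ δ * n) →
        (∃ E₁ E₂ : SimpleGraph (Fin n),
            E₁ ⊔ E₂ = G ∧ E₁ ⊓ E₂ = ⊥ ∧ E₁.CliqueFree 3 ∧ E₂.CliqueFree 6) →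
        (G.edgeSet.ncard : ℝ) ≤ (5 / 12 + ε) * n ^ 2 := by
  intro ε hε
  set η : ℝ := min (ε / 6) 1 with hηdef
  have hη : 0 < η := lt_min (by positivity) one_pos
  have hη1 : η ≤ 1 := min_le_right _ _
  have hηε : 6 * η ≤ ε := by
    have : η ≤ ε / 6 := min_le_left _ _
    linarith
  set ε₁ : ℝ := η ^ 7 / 6 with hε₁def
  have hε₁ : 0 < ε₁ := by positivity
  obtain ⟨m, hm⟩ := exists_nat_ge (1 / η)
  have hm' : (0 : ℝ) < m := lt_of_lt_of_le (by positivity) hm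
  have hm0 : 0 < m := by exact_mod_cast hm'
  obtain ⟨K₀, hK₀⟩ := rt_regularity ε₁ hε₁ m
  set K : ℕ := K₀ + 1 with hK
  have hKpos : (0 : ℝ) < K := by exact_mod_cast Nat.succ_pos K₀
  refine ⟨ε₁ * η / (2 * K), by positivity, m, hm0, ?_⟩
  rintro n hn G hind ⟨E₁, E₂, rfl, hdis, h3, h6⟩
  have hn0 : 0 < n := lt_of_lt_of_le hm0 hn
  have hn' : (0 : ℝ) < n := by exact_mod_cast hn0
  obtain ⟨κ, hκ, c, hcard, href, hm1, hm2⟩ := hK₀ (Fin n) (rtI E₁) (rtI E₂) (rtI_nonneg _) (rtI_le _)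
    (rtI_nonneg _) (rtI_le _) (Fin m) (fun v => ⟨v.val % m, Nat.mod_lt _ hm0⟩) (by simp)
  have hsmall : ∀ i, ((rtCls c i).card : ℝ) ≤ 2 * η * n := by
    intro i
    rcases (rtCls c i).eq_empty_or_nonempty with h | ⟨v, hv⟩
    · rw [h]; simp only [Finset.card_empty, Nat.cast_zero]; positivity
    · have hsub : rtCls c i ⊆ rtCls (fun v : Fin n => (⟨v.val % m, Nat.mod_lt _ hm0⟩ : Fin m))
          ⟨v.val % m, Nat.mod_lt _ hm0⟩ := by
        intro u hu
        rw [rtCls_mem] at hu hv ⊢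
        exact href u v (hu.trans hv.symm)
      have h1 := (Finset.card_le_card hsub).trans (rt_mod_class n m hm0 _)
      have h2 : ((rtCls c i).card : ℝ) ≤ ((n / m : ℕ) : ℝ) + 1 := by exact_mod_cast h1
      have h3 : ((n / m : ℕ) : ℝ) ≤ n / m := Nat.cast_div_le
      have h4 : (1 : ℝ) ≤ n / m := by
        rw [le_div_iff₀ hm', one_mul]; exact_mod_cast hn
      have h5 : (n : ℝ) / m ≤ η * n := by
        rw [div_le_iff₀ hm']
        rw [div_le_iff₀ hη] at hm
        nlinarith
      linarith
  have hcore := rt_core E₁ E₂ hdis h3 h6 η ε₁ (ε₁ * η / (2 * K)) K c hη hη1 hε₁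
    (by rw [hε₁def]; linarith) (Nat.succ_pos _) (hcard.trans (Nat.le_succ _))
    (by simpa using hn0)
    (by
      rw [Fintype.card_fin]
      have h1 : 0 < ε₁ * (η * n / K) := by positivity
      have h2 : ε₁ * η / (2 * K) * n = ε₁ * (η * n / K) / 2 := by field_simp
      rw [h2]; linarith)
    (by rw [Fintype.card_fin]; exact hind)
    (by rw [Fintype.card_fin]; exact hsmall) hm1 hm2
  rw [← rt_edge_count, Fintype.card_fin] at hcore
  have h7 : 6 * η * (n : ℝ) ^ 2 ≤ ε * (n : ℝ) ^ 2 :=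
    mul_le_mul_of_nonneg_right hηε (by positivity)
  linarith
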